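/- arXiv:1303.4982 — 4 statements merged into one kernel-verified Lean document; each statement's English description precedes it below -/
import Mathlib

section
/- Let G be a countable d-regular simple graph, let δ ≤ d be a positive integer, and let g ∈ ℕ ∪ {∞}. Assume that for every k < g and every vertex x of G, the number of cycles of length k in G containing x is at most (d/(12δ))^k. Then G has a spanning subgraph H with girth at least g and minimum degree at least δ. -/
open SimpleGraph

/-- The set of cycles of length `k` in `G` containing the vertex `x`, where a cycle is
identified with its edge set (so that the two traversal directions are not counted twice). -/
def cyclesThrough {V : Type*} (G : SimpleGraph V) (x : V) (k : ℕ) : Set (Set (Sym2 V)) :=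
  {E | ∃ p : G.Walk x x, p.IsCycle ∧ p.length = k ∧ E = {e | e ∈ p.edges}}

section Counting

variable {V X ι : Type*} [Fintype V] [DecidableEq V]

/-- If `P` does not depend on the coordinates in `C` and `Q` depends only on those, then `P` and
`Q` are independent for the uniform distribution on a finite box. -/
theorem card_filter_piFinset_and_mul (Ω : V → Finset X) (C : Finset V) (P Q : (V → X) → Prop)
    [DecidablePred P] [DecidablePred Q]
    (hP : ∀ f f', (∀ v ∉ C, f v = f' v) → P f → P f')
    (hQ : ∀ f f', (∀ v ∈ C, f v = f' v) → Q f → Q f') :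
    ((Fintype.piFinset fun v => Ω v).filter fun f => P f ∧ Q f).card *
        (Fintype.piFinset fun v => Ω v).card =
      ((Fintype.piFinset fun v => Ω v).filter P).card *
        ((Fintype.piFinset fun v => Ω v).filter Q).card := by
  rw [← Finset.card_product, ← Finset.card_product]
  let φ : (V → X) × (V → X) → (V → X) × (V → X) := fun q =>
    (C.piecewise q.2 q.1, C.piecewise q.1 q.2)
  have hφ : ∀ q, φ (φ q) = q := by
    rintro ⟨f, f'⟩
    ext v <;> by_cases hv : v ∈ C <;> simp [φ, hv]
  refine Finset.card_nbij' φ φ ?_ ?_ (fun q _ => hφ q) (fun q _ => hφ q)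
  · rintro ⟨f, f'⟩ h
    simp only [Finset.coe_product, Set.mem_prod, Finset.mem_coe, Finset.mem_filter,
      Fintype.mem_piFinset, φ] at h ⊢
    refine ⟨⟨fun v => ?_, hP f _ (fun v hv => by simp [hv]) h.1.2.1⟩,
      fun v => ?_, hQ f _ (fun v hv => by simp [hv]) h.1.2.2⟩
    · by_cases hv : v ∈ C <;> simp [hv, h.1.1 v, h.2 v]
    · by_cases hv : v ∈ C <;> simp [hv, h.1.1 v, h.2 v]
  · rintro ⟨f, f'⟩ h
    simp only [Finset.coe_product, Set.mem_prod, Finset.mem_coe, Finset.mem_filter,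
      Fintype.mem_piFinset, φ] at h ⊢
    refine ⟨⟨fun v => ?_, hP f _ (fun v hv => by simp [hv]) h.1.2,
      hQ f' _ (fun v hv => by simp [hv]) h.2.2⟩, fun v => ?_⟩
    · by_cases hv : v ∈ C <;> simp [hv, h.1.1 v, h.2.1 v]
    · by_cases hv : v ∈ C <;> simp [hv, h.1.1 v, h.2.1 v]

open Classical in
/-- The elements of the box `∏ v, Ω v` avoiding every event supported inside `S`. -/
noncomputable def avoiding (Ω : V → Finset X) (I : Finset ι) (supp : ι → Finset V)
    (bad : ι → (V → X) → Prop) (S : Finset V) : Finset (V → X) :=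
  (Fintype.piFinset fun v => Ω v).filter fun f => ∀ i ∈ I, supp i ⊆ S → ¬ bad i f

variable {Ω : V → Finset X} {I : Finset ι} {supp : ι → Finset V}
  {bad : ι → (V → X) → Prop} {p : ι → ℝ}

theorem card_avoiding_le_pow_mul {n : ℕ}
    (h : ∀ S : Finset V, S.card < n → ∀ x ∉ S,
      ((avoiding Ω I supp bad S).card : ℝ) ≤ 2 * (avoiding Ω I supp bad (insert x S)).card)
    (T R : Finset V) (hTR : Disjoint T R) (hn : (T ∪ R).card ≤ n) :
    ((avoiding Ω I supp bad T).card : ℝ) ≤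
      2 ^ R.card * (avoiding Ω I supp bad (T ∪ R)).card := by
  induction R using Finset.induction_on with
  | empty => simp
  | insert x R hx ih =>
    rw [Finset.disjoint_insert_right] at hTR
    have hxT : x ∉ T ∪ R := by simp [hx, hTR.1]
    rw [Finset.union_insert, Finset.card_insert_of_notMem hxT] at hn
    rw [Finset.union_insert, Finset.card_insert_of_notMem hx]
    calc _ ≤ 2 ^ R.card * ((avoiding Ω I supp bad (T ∪ R)).card : ℝ) := ih hTR.2 (by omega)
      _ ≤ 2 ^ R.card * (2 * (avoiding Ω I supp bad (insert x (T ∪ R))).card) := by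
        gcongr
        exact h _ (by omega) _ hxT
      _ = _ := by ring

open Classical in
theorem card_avoiding_inter_bad_le (hΩ : ∀ v, (Ω v).Nonempty)
    (hloc : ∀ i f f', (∀ v ∈ supp i, f v = f' v) → bad i f → bad i f')
    {i : ι}
    (hp : (((Fintype.piFinset fun v => Ω v).filter (bad i)).card : ℝ) ≤
      p i * (Fintype.piFinset fun v => Ω v).card) (S : Finset V) :
    (((avoiding Ω I supp bad (S \ supp i)).filter (bad i)).card : ℝ) ≤
      p i * (avoiding Ω I supp bad (S \ supp i)).card := by
  have hpos : (0 : ℝ) < (Fintype.piFinset fun v => Ω v).card := by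
    exact_mod_cast Finset.card_pos.2 (Fintype.piFinset_nonempty.2 hΩ)
  have key := card_filter_piFinset_and_mul Ω (supp i)
    (fun f => ∀ j ∈ I, supp j ⊆ S \ supp i → ¬ bad j f) (bad i)
    (fun f f' hff h j hj hs hb => h j hj hs
      (hloc j f' f (fun v hv => (hff v (Finset.mem_sdiff.1 (hs hv)).2).symm) hb))
    (hloc i)
  rw [← Finset.filter_filter] at key
  change ((avoiding Ω I supp bad (S \ supp i)).filter (bad i)).card * _ =
    (avoiding Ω I supp bad (S \ supp i)).card * _ at key
  have key' : (((avoiding Ω I supp bad (S \ supp i)).filter (bad i)).card : ℝ) *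
      (Fintype.piFinset fun v => Ω v).card = (avoiding Ω I supp bad (S \ supp i)).card *
      ((Fintype.piFinset fun v => Ω v).filter (bad i)).card := by exact_mod_cast key
  refine le_of_mul_le_mul_right ?_ hpos
  rw [key']
  calc _ ≤ ((avoiding Ω I supp bad (S \ supp i)).card : ℝ) *
        (p i * (Fintype.piFinset fun v => Ω v).card) := by gcongr
    _ = _ := by ring

open Classical in
theorem card_avoiding_le_two_mul (hΩ : ∀ v, (Ω v).Nonempty)
    (hloc : ∀ i f f', (∀ v ∈ supp i, f v = f' v) → bad i f → bad i f')
    (hp0 : ∀ i ∈ I, 0 ≤ p i)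
    (hp : ∀ i ∈ I, (((Fintype.piFinset fun v => Ω v).filter (bad i)).card : ℝ) ≤
      p i * (Fintype.piFinset fun v => Ω v).card)
    (hsum : ∀ x, ∑ i ∈ I with x ∈ supp i, p i * 2 ^ ((supp i).card - 1) ≤ 1 / 2)
    (S : Finset V) (x : V) (hx : x ∉ S) :
    ((avoiding Ω I supp bad S).card : ℝ) ≤ 2 * (avoiding Ω I supp bad (insert x S)).card := by
  induction hn : S.card using Nat.strong_induction_on generalizing S x with
  | _ n ih =>
  subst hn
  have hcover : avoiding Ω I supp bad S ⊆ avoiding Ω I supp bad (insert x S) ∪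
      ({i ∈ I | x ∈ supp i}.filter fun i => supp i ⊆ insert x S).biUnion fun i =>
        (avoiding Ω I supp bad (S \ supp i)).filter (bad i) := by
    intro f hf
    simp only [avoiding, Finset.mem_filter, Finset.mem_union, Finset.mem_biUnion] at hf ⊢
    by_cases hgood : ∀ i ∈ I, supp i ⊆ insert x S → ¬ bad i f
    · exact Or.inl ⟨hf.1, hgood⟩
    · push Not at hgood
      obtain ⟨i, hi, hs, hb⟩ := hgood
      refine Or.inr ⟨i, ⟨⟨hi, ?_⟩, hs⟩, ⟨hf.1, fun j hj hjs =>
        hf.2 j hj (hjs.trans Finset.sdiff_subset)⟩, hb⟩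
      by_contra hxi
      exact hf.2 i hi ((Finset.subset_insert_iff_of_notMem hxi).1 hs) hb
  have hterm : ∀ i ∈ {i ∈ I | x ∈ supp i}.filter (fun i => supp i ⊆ insert x S),
      (((avoiding Ω I supp bad (S \ supp i)).filter (bad i)).card : ℝ) ≤
        p i * 2 ^ ((supp i).card - 1) * (avoiding Ω I supp bad S).card := by
    intro i hi
    simp only [Finset.mem_filter] at hi
    obtain ⟨⟨hi, hxi⟩, hs⟩ := hi
    have hins : (supp i).erase x ⊆ S := Finset.subset_insert_iff.1 hs
    have hsd : S \ supp i = S \ (supp i).erase x := by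
      ext v
      simp only [Finset.mem_sdiff, Finset.mem_erase]
      have : v ∈ S → v ≠ x := fun h h' => hx (h' ▸ h)
      tauto
    refine (card_avoiding_inter_bad_le hΩ hloc (hp i hi) S).trans ?_
    rw [mul_assoc]
    refine mul_le_mul_of_nonneg_left ?_ (hp0 i hi)
    have := card_avoiding_le_pow_mul (Ω := Ω) (I := I) (supp := supp) (bad := bad) (n := S.card)
      (fun S' hS' x' hx' => ih _ hS' S' x' hx' rfl) (S \ supp i) ((supp i).erase x)
      (by rw [hsd]; exact Finset.sdiff_disjoint)
      (by rw [hsd, Finset.sdiff_union_of_subset hins])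
    rwa [hsd, Finset.sdiff_union_of_subset hins, Finset.card_erase_of_mem hxi, ← hsd] at this
  have hbound : ((avoiding Ω I supp bad S).card : ℝ) ≤
      (avoiding Ω I supp bad (insert x S)).card + 1 / 2 * (avoiding Ω I supp bad S).card := by
    calc ((avoiding Ω I supp bad S).card : ℝ)
        ≤ (avoiding Ω I supp bad (insert x S)).card +
          ∑ i ∈ {i ∈ I | x ∈ supp i}.filter (fun i => supp i ⊆ insert x S),
            (((avoiding Ω I supp bad (S \ supp i)).filter (bad i)).card : ℝ) := by
          exact_mod_cast (Finset.card_le_card hcover).trans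
            ((Finset.card_union_le _ _).trans (Nat.add_le_add_left Finset.card_biUnion_le _))
      _ ≤ (avoiding Ω I supp bad (insert x S)).card +
          ∑ i ∈ I with x ∈ supp i,
            p i * 2 ^ ((supp i).card - 1) * (avoiding Ω I supp bad S).card := by
          gcongr
          refine (Finset.sum_le_sum hterm).trans
            (Finset.sum_le_sum_of_subset_of_nonneg (Finset.filter_subset _ _) fun i hi _ => ?_)
          have := hp0 i (Finset.mem_filter.1 hi).1
          positivity
      _ ≤ _ := by
          rw [← Finset.sum_mul]
          gcongr
          exact hsum x
  linarith

open Classical in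
/-- A local lemma: bad events with small total weight at each coordinate can be avoided
simultaneously. -/
theorem exists_avoiding (hΩ : ∀ v, (Ω v).Nonempty)
    (hloc : ∀ i f f', (∀ v ∈ supp i, f v = f' v) → bad i f → bad i f')
    (hne : ∀ i ∈ I, (supp i).Nonempty) (hp0 : ∀ i ∈ I, 0 ≤ p i)
    (hp : ∀ i ∈ I, (((Fintype.piFinset fun v => Ω v).filter (bad i)).card : ℝ) ≤
      p i * (Fintype.piFinset fun v => Ω v).card)
    (hsum : ∀ x, ∑ i ∈ I with x ∈ supp i, p i * 2 ^ ((supp i).card - 1) ≤ 1 / 2) :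
    ∃ f : V → X, (∀ v, f v ∈ Ω v) ∧ ∀ i ∈ I, ¬ bad i f := by
  have h := card_avoiding_le_pow_mul (Ω := Ω) (I := I) (supp := supp) (bad := bad)
    (fun S _ x hx => card_avoiding_le_two_mul hΩ hloc hp0 hp hsum S x hx) ∅ Finset.univ
    (Finset.disjoint_empty_left _) le_rfl
  have hempty : avoiding Ω I supp bad ∅ = Fintype.piFinset fun v => Ω v :=
    Finset.filter_true_of_mem fun f _ i hi hs =>
      absurd (Finset.subset_empty.1 hs) (hne i hi).ne_empty
  have hpos : (0 : ℝ) < (avoiding Ω I supp bad ∅).card := by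
    rw [hempty]
    exact_mod_cast Finset.card_pos.2 (Fintype.piFinset_nonempty.2 hΩ)
  have hpos' : (0 : ℝ) < (avoiding Ω I supp bad (∅ ∪ Finset.univ)).card :=
    pos_of_mul_pos_right (hpos.trans_le h) (by positivity)
  obtain ⟨f, hf⟩ := Finset.card_pos.1 (Nat.cast_pos.1 hpos')
  simp only [avoiding, Finset.mem_filter, Fintype.mem_piFinset] at hf
  exact ⟨f, hf.1, fun i hi => hf.2 i hi (by simp)⟩

end Counting

theorem choose_sub_sub_mul_pow_le {d δ j : ℕ} (hj : j ≤ δ) (hδ : δ ≤ d) :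
    (d - j).choose (δ - j) * d ^ j ≤ d.choose δ * δ ^ j := by
  induction j with
  | zero => simp
  | succ j ih =>
    have hrec : (d - j) * (d - (j + 1)).choose (δ - (j + 1)) =
        (d - j).choose (δ - j) * (δ - j) := by
      have := Nat.add_one_mul_choose_eq (d - (j + 1)) (δ - (j + 1))
      rwa [show d - (j + 1) + 1 = d - j by omega, show δ - (j + 1) + 1 = δ - j by omega] at this
    have hcross : (δ - j) * d ≤ δ * (d - j) := by
      rw [Nat.sub_mul, Nat.mul_sub]
      exact Nat.sub_le_sub_left (by nlinarith) _
    refine Nat.le_of_mul_le_mul_left ?_ (show 0 < d - j by omega)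
    calc (d - j) * ((d - (j + 1)).choose (δ - (j + 1)) * d ^ (j + 1))
        = ((d - j).choose (δ - j) * d ^ j) * ((δ - j) * d) := by
          rw [← mul_assoc, hrec]; ring
      _ ≤ (d.choose δ * δ ^ j) * (δ * (d - j)) := Nat.mul_le_mul (ih (by omega)) hcross
      _ = _ := by ring

theorem card_filter_powersetCard_superset_le {α : Type*} [DecidableEq α] {t : Finset α} {δ : ℕ}
    (hδ : δ ≤ t.card) (ht : 0 < t.card) (A : Finset α) :
    (((t.powersetCard δ).filter (A ⊆ ·)).card : ℝ) ≤
      ((δ : ℝ) / t.card) ^ A.card * (t.powersetCard δ).card := by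
  by_cases h : A ⊆ t ∧ A.card ≤ δ
  · rw [Finset.card_filter_powersetCard_subset _ _ _ h.1 h.2, Finset.card_powersetCard, div_pow,
      div_mul_eq_mul_div, le_div_iff₀ (by positivity), mul_comm ((δ : ℝ) ^ _)]
    exact_mod_cast choose_sub_sub_mul_pow_le h.2 hδ
  · have : (t.powersetCard δ).filter (A ⊆ ·) = ∅ := by
      refine Finset.filter_eq_empty_iff.2 fun T hT hAT => h ?_
      rw [Finset.mem_powersetCard] at hT
      exact ⟨hAT.trans hT.1, hT.2 ▸ Finset.card_le_card hAT⟩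
    rw [this]
    simp only [Finset.card_empty, Nat.cast_zero]
    positivity

open Classical in
/-- If each vertex independently selects a random set of edges, containing any given set `A` with
probability at most `q ^ |A|`, then all edges of `A` get selected by one of their at most two
endpoints with probability at most `(2 * q) ^ |A|`. -/
theorem card_filter_forall_selected_le {V α : Type*} [Fintype V] {Ω : V → Finset (Finset α)}
    {q : ℝ} (hq : 0 ≤ q)
    (hΩ : ∀ v A, (((Ω v).filter (A ⊆ ·)).card : ℝ) ≤ q ^ A.card * (Ω v).card)
    (ends : α → Finset V) (hends : ∀ e, (ends e).card ≤ 2) (A : Finset α) :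
    (((Fintype.piFinset fun v => Ω v).filter
        fun f => ∀ e ∈ A, ∃ v ∈ ends e, e ∈ f v).card : ℝ) ≤
      (2 * q) ^ A.card * (Fintype.piFinset fun v => Ω v).card := by
  let B : (A → V) → V → Finset α := fun o v =>
    (Finset.univ.filter fun e : A => o e = v).map (Function.Embedding.subtype _)
  have hB : ∀ o, ∑ v, (B o v).card = A.card := by
    intro o
    simp only [B, Finset.card_map]
    rw [← Finset.card_eq_sum_card_fiberwise (s := Finset.univ) (f := o)
      (fun e _ => Finset.mem_coe.2 (Finset.mem_univ _)), Finset.card_univ, Fintype.card_coe]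
  have hcover : ((Fintype.piFinset fun v => Ω v).filter
      fun f => ∀ e ∈ A, ∃ v ∈ ends e, e ∈ f v) ⊆
      (Fintype.piFinset fun e : A => ends e).biUnion fun o =>
        Fintype.piFinset fun v => (Ω v).filter (B o v ⊆ ·) := by
    intro f hf
    simp only [Finset.mem_filter, Fintype.mem_piFinset] at hf
    choose o ho using hf.2
    simp only [Finset.mem_biUnion, Fintype.mem_piFinset, Finset.mem_filter]
    refine ⟨fun e => o e e.2, fun e => (ho e e.2).1, fun v => ⟨hf.1 v, fun e he => ?_⟩⟩
    simp only [B, Finset.mem_map, Finset.mem_filter, Finset.mem_univ, true_and,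
      Function.Embedding.subtype_apply] at he
    obtain ⟨e', rfl, rfl⟩ := he
    exact (ho _ e'.2).2
  have hone : ∀ o : A → V, ((Fintype.piFinset fun v => (Ω v).filter (B o v ⊆ ·)).card : ℝ) ≤
      q ^ A.card * (Fintype.piFinset fun v => Ω v).card := by
    intro o
    rw [Fintype.card_piFinset, Fintype.card_piFinset, Nat.cast_prod, Nat.cast_prod, ← hB o,
      ← Finset.prod_pow_eq_pow_sum, ← Finset.prod_mul_distrib]
    exact Finset.prod_le_prod (fun _ _ => Nat.cast_nonneg _) fun v _ => hΩ v _
  have hcount : ((Fintype.piFinset fun e : A => ends e).card : ℝ) ≤ 2 ^ A.card := by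
    rw [Fintype.card_piFinset]
    have h := Finset.prod_le_pow_card Finset.univ (fun e : A => (ends e).card) 2
      fun e _ => hends e
    rw [Finset.card_univ, Fintype.card_coe] at h
    exact_mod_cast h
  calc _ ≤ ∑ o ∈ Fintype.piFinset fun e : A => ends e,
        ((Fintype.piFinset fun v => (Ω v).filter (B o v ⊆ ·)).card : ℝ) := by
        exact_mod_cast (Finset.card_le_card hcover).trans Finset.card_biUnion_le
    _ ≤ (Fintype.piFinset fun e : A => ends e).card *
        (q ^ A.card * (Fintype.piFinset fun v => Ω v).card) := by
        rw [← nsmul_eq_mul]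
        exact Finset.sum_le_card_nsmul _ _ _ fun o _ => hone o
    _ ≤ 2 ^ A.card * (q ^ A.card * (Fintype.piFinset fun v => Ω v).card) := by gcongr
    _ = _ := by rw [mul_pow]; ring

theorem sum_range_third_pow_succ_le (n : ℕ) :
    ∑ k ∈ Finset.range n, ((1 : ℝ) / 3) ^ (k + 1) ≤ 1 / 2 := by
  have h : ∑ k ∈ Finset.range n, ((1 : ℝ) / 3) ^ (k + 1) = 1 / 2 - 1 / 2 * (1 / 3) ^ n := by
    induction n with
    | zero => simp
    | succ n ih => rw [Finset.sum_range_succ, ih]; ring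
  rw [h]
  have : (0 : ℝ) ≤ (1 / 3) ^ n := by positivity
  linarith

section Cycles

variable {V : Type*} {G : SimpleGraph V}

/-- `A` is the edge set of a cycle of `G` of length less than `g`. -/
def IsShortCycle [DecidableEq V] (G : SimpleGraph V) (g : ℕ∞) (A : Finset (Sym2 V)) : Prop :=
  ∃ (x : V) (p : G.Walk x x), p.IsCycle ∧ (p.length : ℕ∞) < g ∧ A = p.edges.toFinset

variable [DecidableEq V]

theorem card_toFinset_edges {x : V} {p : G.Walk x x} (hp : p.IsCycle) :
    p.edges.toFinset.card = p.length := by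
  rw [List.toFinset_card_of_nodup hp.edges_nodup, Walk.length_edges]

theorem IsShortCycle.card_pos {g : ℕ∞} {A : Finset (Sym2 V)} (hA : IsShortCycle G g A) :
    0 < A.card := by
  obtain ⟨x, p, hp, -, rfl⟩ := hA
  rw [card_toFinset_edges hp]
  exact lt_of_lt_of_le (by norm_num) hp.three_le_length

theorem IsShortCycle.card_lt {g : ℕ∞} {A : Finset (Sym2 V)} (hA : IsShortCycle G g A) :
    (A.card : ℕ∞) < g := by
  obtain ⟨x, p, hp, hg, rfl⟩ := hA
  rwa [card_toFinset_edges hp]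

theorem IsShortCycle.coe_mem_cyclesThrough {g : ℕ∞} {A : Finset (Sym2 V)}
    (hA : IsShortCycle G g A) {v : V} {e : Sym2 V} (he : e ∈ A) (hv : v ∈ e) :
    (A : Set (Sym2 V)) ∈ cyclesThrough G v A.card := by
  obtain ⟨x, p, hp, -, rfl⟩ := hA
  have hvp : v ∈ p.support := Walk.mem_support_of_mem_edges (List.mem_toFinset.1 he) hv
  refine ⟨p.rotate v hvp, hp.rotate hvp, ?_, ?_⟩
  · rw [card_toFinset_edges hp, Walk.length_rotate]
  · ext e'
    simp [(p.rotate_edges v hvp).mem_iff]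

theorem IsShortCycle.card_le {g : ℕ∞} {A : Finset (Sym2 V)} (hA : IsShortCycle G g A)
    (S : Finset V) (hS : ∀ v ∈ S, ∃ e ∈ A, v ∈ e) : S.card ≤ A.card := by
  obtain ⟨x, p, hp, -, rfl⟩ := hA
  have hsub : S ⊆ p.support.tail.toFinset := by
    intro v hv
    obtain ⟨e, he, hve⟩ := hS v hv
    have hvp : v ∈ p.support := Walk.mem_support_of_mem_edges (List.mem_toFinset.1 he) hve
    rw [List.mem_toFinset]
    rcases (Walk.mem_support_iff p).1 hvp with rfl | h
    · exact Walk.end_mem_tail_support hp.not_nil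
    · exact h
  refine (Finset.card_le_card hsub).trans ((List.toFinset_card_le _).trans ?_)
  rw [card_toFinset_edges hp, List.length_tail, Walk.length_support, Nat.add_sub_cancel]

theorem finite_cyclesThrough [G.LocallyFinite] (x : V) (k : ℕ) :
    (cyclesThrough G x k).Finite := by
  refine ((Set.toFinite {p : G.Walk x x | p.length = k}).image fun p => {e | e ∈ p.edges}).subset ?_
  rintro E ⟨p, -, hk, rfl⟩
  exact ⟨p, hk, rfl⟩

/-- The total weight of short cycles through a fixed vertex. -/
theorem sum_isShortCycle_le [G.LocallyFinite] {g : ℕ∞} {d δ : ℕ} (hδ : 0 < δ) (hd : 0 < d)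
    (hcyc : ∀ k : ℕ, (k : ℕ∞) < g → ∀ x : V,
      ((cyclesThrough G x k).ncard : ℝ) ≤ ((d : ℝ) / (12 * δ)) ^ k)
    (x : V) (J : Finset (Finset (Sym2 V)))
    (hJ : ∀ A ∈ J, IsShortCycle G g A ∧ ∃ e ∈ A, x ∈ e) :
    ∑ A ∈ J, (2 * ((δ : ℝ) / d)) ^ A.card * 2 ^ A.card ≤ 1 / 2 := by
  have hfiber : ∀ k : ℕ, ∑ A ∈ J with A.card = k + 1,
      (2 * ((δ : ℝ) / d)) ^ A.card * 2 ^ A.card ≤ (1 / 3) ^ (k + 1) := by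
    intro k
    by_cases hk : ((k + 1 : ℕ) : ℕ∞) < g
    · have hcard : ((J.filter fun A => A.card = k + 1).card : ℝ) ≤
          ((d : ℝ) / (12 * δ)) ^ (k + 1) := by
        refine le_trans ?_ (hcyc (k + 1) hk x)
        rw [← Set.ncard_coe_finset, ← Set.ncard_image_of_injective _
          (Finset.coe_injective (α := Sym2 V))]
        refine Nat.cast_le.2 (Set.ncard_le_ncard ?_ (finite_cyclesThrough x _))
        rintro _ ⟨A, hA, rfl⟩
        obtain ⟨hAJ, hAk⟩ := Finset.mem_filter.1 (Finset.mem_coe.1 hA)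
        obtain ⟨hs, e, he, hx⟩ := hJ A hAJ
        exact hAk ▸ hs.coe_mem_cyclesThrough he hx
      calc _ = ∑ A ∈ J with A.card = k + 1, (4 * ((δ : ℝ) / d)) ^ (k + 1) := by
            refine Finset.sum_congr rfl fun A hA => ?_
            rw [(Finset.mem_filter.1 hA).2, ← mul_pow]
            ring
        _ ≤ ((d : ℝ) / (12 * δ)) ^ (k + 1) * (4 * ((δ : ℝ) / d)) ^ (k + 1) := by
            rw [Finset.sum_const, nsmul_eq_mul]
            gcongr
        _ = (1 / 3) ^ (k + 1) := by
            rw [← mul_pow]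
            congr 1
            field_simp
            norm_num
    · rw [Finset.filter_false_of_mem, Finset.sum_empty]
      · positivity
      · intro A hA h
        exact hk (h ▸ (hJ A hA).1.card_lt)
  have hmaps : ∀ A ∈ J, A.card - 1 ∈ Finset.range (J.sup Finset.card) := by
    intro A hA
    have h1 := (hJ A hA).1.card_pos
    have h2 : A.card ≤ J.sup Finset.card := Finset.le_sup hA
    exact Finset.mem_range.2 (by omega)
  rw [← Finset.sum_fiberwise_of_maps_to hmaps]
  refine le_trans (Finset.sum_le_sum fun k _ => ?_) (sum_range_third_pow_succ_le _)
  rw [show J.filter (fun A => A.card - 1 = k) = J.filter (fun A => A.card = k + 1) from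
    Finset.filter_congr fun A hA => by have := (hJ A hA).1.card_pos; omega]
  exact hfiber k

/-- On a finite vertex set, every vertex can select `δ` incident edges so that no short cycle
consists of selected edges. -/
theorem exists_selection_finset [G.LocallyFinite] {g : ℕ∞} {d δ : ℕ} (hδ : 0 < δ) (hδd : δ ≤ d)
    (hreg : ∀ v, (G.incidenceFinset v).card = d)
    (hcyc : ∀ k : ℕ, (k : ℕ∞) < g → ∀ x : V,
      ((cyclesThrough G x k).ncard : ℝ) ≤ ((d : ℝ) / (12 * δ)) ^ k) (s : Finset V) :
    ∃ f : s → Finset (Sym2 V), (∀ v : s, f v ∈ (G.incidenceFinset v).powersetCard δ) ∧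
      ∀ A, IsShortCycle G g A → A ⊆ s.sym2 → ¬ ∀ e ∈ A, ∃ v : s, (v : V) ∈ e ∧ e ∈ f v := by
  classical
  have hd : 0 < d := hδ.trans_le hδd
  let ends : Sym2 V → Finset s := fun e => Finset.univ.filter fun v : s => (v : V) ∈ e
  let I : Finset (Finset (Sym2 V)) := s.sym2.powerset.filter (IsShortCycle G g)
  let supp : Finset (Sym2 V) → Finset s := fun A =>
    Finset.univ.filter fun v : s => ∃ e ∈ A, (v : V) ∈ e
  have hends : ∀ e, (ends e).card ≤ 2 := by
    intro e
    rw [← Finset.card_map (Function.Embedding.subtype _)]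
    refine (Finset.card_le_card (t := e.toFinset) ?_).trans ?_
    · intro v hv
      simp only [ends, Finset.mem_map, Finset.mem_filter, Finset.mem_univ, true_and,
        Function.Embedding.subtype_apply] at hv
      obtain ⟨w, hw, rfl⟩ := hv
      exact Sym2.mem_toFinset.2 hw
    · rw [Sym2.card_toFinset]
      split_ifs <;> norm_num
  have hcardsupp : ∀ A ∈ I, (supp A).card ≤ A.card := by
    intro A hA
    rw [← Finset.card_map (Function.Embedding.subtype _)]
    refine (Finset.mem_filter.1 hA).2.card_le _ fun v hv => ?_
    simp only [supp, Finset.mem_map, Finset.mem_filter, Finset.mem_univ, true_and,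
      Function.Embedding.subtype_apply] at hv
    obtain ⟨w, hw, rfl⟩ := hv
    exact hw
  have hloc : ∀ (A : Finset (Sym2 V)) (f f' : s → Finset (Sym2 V)),
      (∀ v ∈ supp A, f v = f' v) → (∀ e ∈ A, ∃ v ∈ ends e, e ∈ f v) →
        ∀ e ∈ A, ∃ v ∈ ends e, e ∈ f' v := by
    intro A f f' hff hb e he
    obtain ⟨v, hv, hev⟩ := hb e he
    refine ⟨v, hv, hff v ?_ ▸ hev⟩
    exact Finset.mem_filter.2 ⟨Finset.mem_univ _, e, he, (Finset.mem_filter.1 hv).2⟩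
  have hne : ∀ A ∈ I, (supp A).Nonempty := by
    intro A hA
    obtain ⟨hAs, hA⟩ := Finset.mem_filter.1 hA
    obtain ⟨e, he⟩ := Finset.card_pos.1 hA.card_pos
    have hes := Finset.mem_powerset.1 hAs he
    induction e using Sym2.ind with
    | _ a b =>
    exact ⟨⟨a, (Finset.mk_mem_sym2_iff.1 hes).1⟩,
      Finset.mem_filter.2 ⟨Finset.mem_univ _, _, he, Sym2.mem_mk_left a b⟩⟩
  have hsum : ∀ x : s, ∑ A ∈ I with x ∈ supp A,
      (2 * ((δ : ℝ) / d)) ^ A.card * 2 ^ ((supp A).card - 1) ≤ 1 / 2 := by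
    intro x
    refine le_trans (Finset.sum_le_sum fun A hA => ?_)
      (sum_isShortCycle_le hδ hd hcyc x (I.filter fun A => x ∈ supp A) fun A hA => ?_)
    · have hle : (supp A).card - 1 ≤ A.card :=
        (Nat.sub_le _ _).trans (hcardsupp A (Finset.mem_filter.1 hA).1)
      exact mul_le_mul_of_nonneg_left (pow_le_pow_right₀ one_le_two hle) (by positivity)
    · obtain ⟨hA, hx⟩ := Finset.mem_filter.1 hA
      exact ⟨(Finset.mem_filter.1 hA).2, (Finset.mem_filter.1 hx).2⟩
  have hprob : ∀ (v : s) (B : Finset (Sym2 V)),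
      ((((G.incidenceFinset (v : V)).powersetCard δ).filter (B ⊆ ·)).card : ℝ) ≤
        ((δ : ℝ) / d) ^ B.card * ((G.incidenceFinset (v : V)).powersetCard δ).card := by
    intro v B
    have h := card_filter_powersetCard_superset_le (t := G.incidenceFinset (v : V)) (δ := δ)
      (by rw [hreg]; exact hδd) (by rw [hreg]; exact hd) B
    rw [hreg] at h
    convert h
  have hbad := card_filter_forall_selected_le
    (Ω := fun v : s => (G.incidenceFinset (v : V)).powersetCard δ)
    (q := (δ : ℝ) / d) (by positivity)
    (fun v B => by convert hprob v B) ends hends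
  obtain ⟨f, hf, hgood⟩ := exists_avoiding
    (Ω := fun v : s => (G.incidenceFinset (v : V)).powersetCard δ) (I := I) (supp := supp)
    (bad := fun A f => ∀ e ∈ A, ∃ v ∈ ends e, e ∈ f v)
    (p := fun A => (2 * ((δ : ℝ) / d)) ^ A.card)
    (fun v => Finset.powersetCard_nonempty.2 (by rw [hreg]; exact hδd))
    hloc hne (fun A _ => by positivity) (fun A _ => by convert hbad A)
    (fun x => by convert hsum x)
  refine ⟨f, hf, fun A hA hAs hb => hgood A
    (Finset.mem_filter.2 ⟨Finset.mem_powerset.2 hAs, hA⟩) fun e he => ?_⟩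
  obtain ⟨v, hv, hev⟩ := hb e he
  exact ⟨v, Finset.mem_filter.2 ⟨Finset.mem_univ _, hv⟩, hev⟩

/-- Every vertex can select `δ` incident edges so that no short cycle consists of selected
edges. -/
theorem exists_selection [G.LocallyFinite] {g : ℕ∞} {d δ : ℕ} (hδ : 0 < δ) (hδd : δ ≤ d)
    (hreg : ∀ v, (G.incidenceFinset v).card = d)
    (hcyc : ∀ k : ℕ, (k : ℕ∞) < g → ∀ x : V,
      ((cyclesThrough G x k).ncard : ℝ) ≤ ((d : ℝ) / (12 * δ)) ^ k) :
    ∃ f : V → Finset (Sym2 V), (∀ v, f v ∈ (G.incidenceFinset v).powersetCard δ) ∧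
      ∀ A, IsShortCycle G g A → ¬ ∀ e ∈ A, ∃ v ∈ e, e ∈ f v := by
  choose F hF hgood using exists_selection_finset hδ hδd hreg hcyc
  obtain ⟨χ, hχ⟩ := Finset.rado_selection_subtype
    (β := fun v => (G.incidenceFinset v).powersetCard δ) fun s v => ⟨F s v, hF s v⟩
  refine ⟨fun v => χ v, fun v => (χ v).2, fun A hA hb => ?_⟩
  obtain ⟨t, hst, ht⟩ := hχ (A.biUnion Sym2.toFinset)
  have hmem : ∀ e ∈ A, ∀ v ∈ e, v ∈ A.biUnion Sym2.toFinset := fun e he v hv =>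
    Finset.mem_biUnion.2 ⟨e, he, Sym2.mem_toFinset.2 hv⟩
  refine hgood t A hA (fun e he => Finset.mem_sym2_iff.2 fun v hv => hst (hmem e he v hv)) ?_
  intro e he
  obtain ⟨v, hv, hev⟩ := hb e he
  refine ⟨⟨v, hst (hmem e he v hv)⟩, hv, ?_⟩
  have heq : (χ v : Finset (Sym2 V)) = F t ⟨v, hst (hmem e he v hv)⟩ :=
    congrArg Subtype.val (ht ⟨v, hmem e he v hv⟩)
  exact heq ▸ hev

end Cycles

/-- Let `G` be a countable `d`-regular simple graph, `0 < δ ≤ d` and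
`g ∈ ℕ ∪ {∞}`. If for every `k < g` and every vertex `x` the number of cycles of length `k`
through `x` is at most `(d/(12δ))^k`, then `G` has a spanning subgraph `H` with girth at
least `g` and minimum degree at least `δ`. -/
theorem expanders_spanning_subgraph_large_girth
    {V : Type*} [Countable V] (G : SimpleGraph V) (d δ : ℕ)
    (hδpos : 0 < δ) (hδd : δ ≤ d)
    (hreg : ∀ x : V, (G.neighborSet x).ncard = d)
    (g : ℕ∞)
    (hcyc : ∀ k : ℕ, (k : ℕ∞) < g → ∀ x : V,
      ((cyclesThrough G x k).ncard : ℝ) ≤ ((d : ℝ) / (12 * δ)) ^ k) :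
    ∃ H : SimpleGraph V, H ≤ G ∧ g ≤ H.egirth ∧
      ∀ x : V, δ ≤ (H.neighborSet x).ncard := by
  classical
  have hfin : ∀ x, (G.neighborSet x).Finite := fun x =>
    Set.finite_of_ncard_pos (by rw [hreg]; omega)
  let _ : G.LocallyFinite := fun x => (hfin x).fintype
  have hinc : ∀ v, (G.incidenceFinset v).card = d := fun v => by
    rw [card_incidenceFinset_eq_degree, ← hreg v, Set.ncard_eq_toFinset_card']
    rfl
  obtain ⟨f, hf, hgood⟩ := exists_selection hδpos hδd hinc hcyc
  have hfinc : ∀ v, ∀ e ∈ f v, e ∈ G.edgeSet ∧ v ∈ e := fun v e he =>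
    (mem_incidenceFinset _ _ e).1 ((Finset.mem_powersetCard.1 (hf v)).1 he)
  have hle : fromEdgeSet {e | ∃ v, e ∈ f v} ≤ G := by
    intro a b hab
    obtain ⟨⟨v, hv⟩, -⟩ := (fromEdgeSet_adj _).1 hab
    exact (hfinc v _ hv).1
  refine ⟨fromEdgeSet {e | ∃ v, e ∈ f v}, hle, le_egirth.2 fun a w hw => ?_, fun x => ?_⟩
  · by_contra! hlt
    refine hgood w.edges.toFinset ⟨a, w.mapLe hle, hw.mapLe hle, by simpa using hlt, by simp⟩ ?_
    intro e he
    have := w.edges_subset_edgeSet (List.mem_toFinset.1 he)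
    rw [edgeSet_fromEdgeSet] at this
    obtain ⟨v, hv⟩ := this.1
    exact ⟨v, (hfinc v e hv).2, hv⟩
  · have hNfin : ((fromEdgeSet {e | ∃ v, e ∈ f v}).neighborSet x).Finite :=
      (hfin x).subset fun y hy => hle hy
    rw [← (Finset.mem_powersetCard.1 (hf x)).2, ← Set.ncard_coe_finset]
    refine le_trans (Set.ncard_le_ncard ?_ (hNfin.image fun y => s(x, y)))
      (Set.ncard_image_le hNfin)
    intro e he
    obtain ⟨hG, hx⟩ := hfinc x e he
    obtain ⟨y, rfl⟩ := hx
    exact ⟨y, (fromEdgeSet_adj _).2 ⟨⟨x, he⟩, G.ne_of_adj hG⟩, rfl⟩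
end

section
/- Let d, D, g be positive integers with D > (12d)^g, and let G be a countable D-regular simple graph. Then G has a spanning subgraph with minimum degree at least d and girth at least g. -/
open SimpleGraph Function

/-- The graph in which each slot `s = (x, i)` joins `x` to `f s`. A slot with `f (x, i) = x` is
regarded as empty and contributes nothing. -/
def slotGraph {V ι : Type*} (f : V × ι → V) : SimpleGraph V where
  Adj a b := a ≠ b ∧ ∃ s, s(s.1, f s) = s(a, b)
  symm := ⟨fun _ _ h => ⟨h.1.symm, h.2.imp fun _ hs => hs.trans Sym2.eq_swap⟩⟩
  loopless := ⟨fun _ h => h.1 rfl⟩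

section Slots

variable {V ι : Type*} [DecidableEq V] [DecidableEq ι]

/-- Make the slot `s` empty. -/
def clearSlot (f : V × ι → V) (s : V × ι) : V × ι → V := update f s s.1

/-- No slot closes a cycle of length less than `g` with the other slots; two slots joining the same
pair of vertices count as a cycle of length two. -/
def NoShortCycle (g : ℕ) (f : V × ι → V) : Prop :=
  ∀ s, f s ≠ s.1 → ∀ w : (slotGraph (clearSlot f s)).Walk s.1 (f s), g ≤ w.length + 1

/-- Some `m` distinct nonempty slots form a walk from `a` to `b`. -/
def SlotChain : ℕ → (V × ι → V) → V → V → Prop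
  | 0, _, a, b => a = b
  | m + 1, f, a, b => ∃ s c, f s ≠ s.1 ∧ s(s.1, f s) = s(a, c) ∧ SlotChain m (clearSlot f s) c b

theorem clearSlot_comm (f : V × ι → V) (s t : V × ι) :
    clearSlot (clearSlot f s) t = clearSlot (clearSlot f t) s := by
  by_cases h : s = t
  · rw [h]
  · exact update_comm h _ _ _

theorem slotGraph_clearSlot_le (f : V × ι → V) (s : V × ι) :
    slotGraph (clearSlot f s) ≤ slotGraph f := by
  rintro a b ⟨hab, t, ht⟩
  refine ⟨hab, t, ?_⟩
  by_cases hts : t = s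
  · subst hts
    simp only [clearSlot, update_self, Sym2.eq_iff] at ht
    grind
  · rwa [clearSlot, update_of_ne hts] at ht

theorem mem_edgeSet_slotGraph_clearSlot {f : V × ι → V} {s : V × ι} {e : Sym2 V}
    (he : e ∈ (slotGraph f).edgeSet) (hes : e ≠ s(s.1, f s)) :
    e ∈ (slotGraph (clearSlot f s)).edgeSet := by
  induction e with | _ a b
  obtain ⟨hab, t, ht⟩ := he
  refine ⟨hab, t, ?_⟩
  rwa [clearSlot, update_of_ne]
  rintro rfl
  exact hes ht.symm

theorem slotGraph_update_adj {f : V × ι → V} {s : V × ι} {v a b : V}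
    (h : (slotGraph (update f s v)).Adj a b) :
    (slotGraph f).Adj a b ∨ s(s.1, v) = s(a, b) := by
  obtain ⟨hab, t, ht⟩ := h
  by_cases hts : t = s
  · subst hts
    right
    simpa using ht
  · exact Or.inl ⟨hab, t, by rwa [update_of_ne hts] at ht⟩

theorem NoShortCycle.clearSlot {g : ℕ} {f : V × ι → V} (hf : NoShortCycle g f) (t : V × ι) :
    NoShortCycle g (clearSlot f t) := by
  intro s hs w
  have hst : s ≠ t := by
    rintro rfl
    simp [_root_.clearSlot] at hs
  have hval : _root_.clearSlot f t s = f s := update_of_ne hst _ _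
  obtain ⟨w', hw'⟩ : ∃ w' : (slotGraph (_root_.clearSlot (_root_.clearSlot f s) t)).Walk s.1 (f s),
      w'.length = w.length := by
    rw [clearSlot_comm, ← hval]
    exact ⟨w, rfl⟩
  have := hf s (hval ▸ hs) (w'.mapLe (slotGraph_clearSlot_le _ t))
  rwa [Walk.length_mapLe, hw'] at this

theorem Walk.split_slotGraph_update {f : V × ι → V} {s : V × ι} {v a b : V}
    (w : (slotGraph (update f s v)).Walk a b) :
    (∃ w' : (slotGraph f).Walk a b, w'.length ≤ w.length) ∨
    ∃ x y, s(s.1, v) = s(x, y) ∧ ∃ (p : (slotGraph f).Walk a x) (q : (slotGraph f).Walk y b),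
      p.length + q.length + 1 ≤ w.length := by
  induction w with
  | nil => exact Or.inl ⟨.nil, le_rfl⟩
  | @cons a c b h w ih =>
    rcases ih with ⟨w', hw'⟩ | ⟨x, y, hxy, p, q, hpq⟩
    · rcases slotGraph_update_adj h with h' | h'
      · exact Or.inl ⟨.cons h' w', by simpa using hw'⟩
      · exact Or.inr ⟨a, c, h', .nil, w', by simpa using hw'⟩
    · rcases slotGraph_update_adj h with h' | h'
      · exact Or.inr ⟨x, y, hxy, .cons h' p, q, by simp only [Walk.length_cons]; omega⟩
      · rcases Sym2.eq_iff.1 (hxy.symm.trans h') with ⟨rfl, rfl⟩ | ⟨rfl, rfl⟩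
        · exact Or.inr ⟨x, y, hxy, .nil, q, by
            simp only [Walk.length_cons, Walk.length_nil]; omega⟩
        · exact Or.inl ⟨q, by simp only [Walk.length_cons]; omega⟩

theorem exists_short_walk_of_update {g : ℕ} {f : V × ι → V} {s : V × ι} {v : V}
    (hf : NoShortCycle g f) (hs : f s = s.1) (hupd : ¬ NoShortCycle g (update f s v)) :
    ∃ w : (slotGraph f).Walk s.1 v, w.length + 1 < g := by
  simp only [NoShortCycle, not_forall, not_le] at hupd
  obtain ⟨t, ht, w, hw⟩ := hupd
  by_cases hts : t = s
  · subst hts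
    have hclear : clearSlot (update f t v) t = f := by simp [clearSlot, ← hs]
    rw [← hclear]
    exact ⟨w.copy rfl (update_self _ _ _), by simpa using hw⟩
  · have hval : update f s v t = f t := update_of_ne hts _ _
    have hcomm : clearSlot (update f s v) t = update (clearSlot f t) s v :=
      update_comm (Ne.symm hts) _ _ _
    obtain ⟨w', hw'⟩ : ∃ w' : (slotGraph (update (clearSlot f t) s v)).Walk t.1 (f t),
        w'.length = w.length := by
      rw [← hcomm, ← hval]
      exact ⟨w, rfl⟩
    rw [hval] at ht
    rcases Walk.split_slotGraph_update w' with ⟨p, hp⟩ | ⟨x, y, hxy, p, q, hpq⟩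
    · have := hf t ht p
      omega
    · have hadj : (slotGraph f).Adj (f t) t.1 := ⟨ht, t, Sym2.eq_swap⟩
      have hle := slotGraph_clearSlot_le f t
      have hlen : ((q.mapLe hle).append (.cons hadj (p.mapLe hle))).length + 1 < g := by
        simp only [Walk.length_append, Walk.length_cons, Walk.length_mapLe]
        omega
      rcases Sym2.eq_iff.1 hxy with ⟨rfl, rfl⟩ | ⟨rfl, rfl⟩
      · exact ⟨_, (Walk.length_reverse _).symm ▸ hlen⟩
      · exact ⟨_, hlen⟩

theorem slotChain_of_isPath (n : ℕ) : ∀ (f : V × ι → V) {a b : V} (w : (slotGraph f).Walk a b),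
    w.IsPath → w.length = n → SlotChain n f a b := by
  induction n with
  | zero => exact fun f a b w _ hn => Walk.eq_of_length_eq_zero hn
  | succ n ih =>
    rintro f a b (_ | ⟨h, q⟩) hp hn
    · simp at hn
    · rename_i c
      rw [Walk.cons_isPath_iff] at hp
      obtain ⟨hac, s, hs⟩ := id h
      have hq : ∀ e ∈ q.edges, e ∈ (slotGraph (clearSlot f s)).edgeSet := by
        intro e he
        refine mem_edgeSet_slotGraph_clearSlot (q.edges_subset_edgeSet he) ?_
        rintro rfl
        rw [hs] at he
        exact hp.2 (q.fst_mem_support_of_mem_edges he)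
      refine ⟨s, c, ?_, hs, ih _ (q.transfer _ hq) (hp.1.transfer hq) ?_⟩
      · intro hfs
        rw [hfs, Sym2.eq_iff] at hs
        grind
      · simpa using hn

theorem exists_slotChain_of_update {g : ℕ} {f : V × ι → V} {s : V × ι} {v : V}
    (hf : NoShortCycle g f) (hs : f s = s.1) (hupd : ¬ NoShortCycle g (update f s v)) :
    ∃ m < g - 1, SlotChain m f s.1 v := by
  obtain ⟨w, hw⟩ := exists_short_walk_of_update hf hs hupd
  have := w.length_bypass_le_length
  exact ⟨_, by omega, slotChain_of_isPath _ f w.bypass w.bypass_isPath rfl⟩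

theorem le_egirth_slotGraph {g : ℕ} {f : V × ι → V} (hf : NoShortCycle g f) :
    (g : ℕ∞) ≤ (slotGraph f).egirth := by
  rw [le_egirth]
  rintro a (_ | ⟨h, q⟩) hc
  · simp at hc
  · rename_i c
    rw [Walk.cons_isCycle_iff] at hc
    obtain ⟨hac, s, hs⟩ := id h
    have hq : ∀ e ∈ q.edges, e ∈ (slotGraph (clearSlot f s)).edgeSet := fun e he =>
      mem_edgeSet_slotGraph_clearSlot (q.edges_subset_edgeSet he) (by
        rintro rfl
        exact hc.2 (hs ▸ he))
    have hne : f s ≠ s.1 := by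
      intro hfs
      rw [hfs, Sym2.eq_iff] at hs
      grind
    rw [Walk.length_cons]
    rcases Sym2.eq_iff.1 hs with ⟨h1, h2⟩ | ⟨h1, h2⟩
    · have := hf s hne ((q.transfer _ hq).reverse.copy h1.symm h2.symm)
      rw [Walk.length_copy, Walk.length_reverse, Walk.length_transfer] at this
      exact_mod_cast this
    · have := hf s hne ((q.transfer _ hq).copy h1.symm h2.symm)
      rw [Walk.length_copy, Walk.length_transfer] at this
      exact_mod_cast this

theorem NoShortCycle.injective {g : ℕ} {f : V × ι → V} (hf : NoShortCycle g f) (hg : 3 ≤ g)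
    (hne : ∀ s, f s ≠ s.1) (x : V) : Injective fun i => f (x, i) := by
  intro i j hij
  by_contra hne'
  have hadj : (slotGraph (_root_.clearSlot f (x, i))).Adj x (f (x, i)) := by
    refine ⟨(hne (x, i)).symm, (x, j), ?_⟩
    rw [_root_.clearSlot, update_of_ne (by simpa using Ne.symm hne')]
    exact congrArg _ hij.symm
  have := hf (x, i) (hne _) hadj.toWalk
  simp at this
  omega

/-- A walk of `slotGraph f` uses finitely many slots. -/
theorem exists_finset_walk_of_agree {f : V × ι → V} {a b : V} (w : (slotGraph f).Walk a b) :
    ∃ S : Finset (V × ι), ∀ f' : V × ι → V, (∀ s ∈ S, f' s = f s) →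
      ∃ w' : (slotGraph f').Walk a b, w'.length = w.length := by
  induction w with
  | nil => exact ⟨∅, fun f' _ => ⟨.nil, rfl⟩⟩
  | @cons a b _ h w ih =>
    obtain ⟨S, hS⟩ := ih
    obtain ⟨hab, s, hs⟩ := id h
    refine ⟨insert s S, fun f' hf' => ?_⟩
    obtain ⟨w', hw'⟩ := hS f' fun t ht => hf' t (Finset.mem_insert_of_mem ht)
    have hadj : (slotGraph f').Adj a b :=
      ⟨hab, s, by rw [hf' s (Finset.mem_insert_self _ _), hs]⟩
    exact ⟨.cons hadj w', by simp only [Walk.length_cons, hw']⟩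

/-- The fillings of exactly the slots in `S` by neighbors in `G` that close no short cycle. -/
def slotFillings (G : SimpleGraph V) (g : ℕ) (S : Finset (V × ι)) : Set (V × ι → V) :=
  {f | (∀ s ∈ S, G.Adj s.1 (f s)) ∧ (∀ s ∉ S, f s = s.1) ∧ NoShortCycle g f}

/-- The pairs of a filling of `S` and an end of an `m`-slot chain starting from `a`. -/
def chainPairs (G : SimpleGraph V) (g : ℕ) (S : Finset (V × ι)) (m : ℕ) (a : V) :
    Set ((V × ι → V) × V) :=
  {p | p.1 ∈ slotFillings G g S ∧ SlotChain m p.1 a p.2}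

variable {G : SimpleGraph V} {g : ℕ}

theorem clearSlot_mem_slotFillings {S : Finset (V × ι)} {f : V × ι → V}
    (hf : f ∈ slotFillings G g S) (s : V × ι) :
    clearSlot f s ∈ slotFillings G g (S.erase s) := by
  refine ⟨fun t ht => ?_, fun t ht => ?_, hf.2.2.clearSlot s⟩
  · rw [clearSlot, update_of_ne (Finset.ne_of_mem_erase ht)]
    exact hf.1 t (Finset.mem_of_mem_erase ht)
  · by_cases hts : t = s
    · rw [hts, clearSlot, update_self]
    · rw [clearSlot, update_of_ne hts]
      exact hf.2.1 t fun h => ht (Finset.mem_erase.2 ⟨hts, h⟩)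

theorem update_clearSlot (f : V × ι → V) (s : V × ι) : update (clearSlot f s) s (f s) = f := by
  simp [clearSlot]

theorem slotFillings_empty : slotFillings G g (∅ : Finset (V × ι)) = {Prod.fst} := by
  ext f
  simp only [slotFillings, Set.mem_ofPred_eq, Set.mem_singleton_iff]
  constructor
  · exact fun h => funext fun s => h.2.1 s (Finset.notMem_empty s)
  · rintro rfl
    exact ⟨by simp, by simp, fun s hs => absurd rfl hs⟩

theorem finite_slotFillings (hfin : ∀ x, (G.neighborSet x).Finite) (S : Finset (V × ι)) :
    (slotFillings G g S).Finite := by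
  induction S using Finset.induction_on with
  | empty => simp [slotFillings_empty]
  | insert s S hs ih =>
    refine (ih.image2 (fun f v => update f s v) (hfin s.1)).subset fun f hf => ?_
    have hmem := clearSlot_mem_slotFillings hf s
    rw [Finset.erase_insert hs] at hmem
    exact ⟨_, hmem, f s, hf.1 s (Finset.mem_insert_self _ _), update_clearSlot f s⟩

theorem chainPairs_succ_subset [Fintype ι] {S : Finset (V × ι)} {m : ℕ} {a : V} {N : Finset V}
    (hN : ∀ v, v ∈ N ↔ G.Adj a v) :
    chainPairs G g S (m + 1) a ⊆
      (⋃ q ∈ (N ×ˢ (Finset.univ : Finset ι)).filter (fun q => (a, q.2) ∈ S),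
        (fun p => (update p.1 (a, q.2) q.1, p.2)) '' chainPairs G g (S.erase (a, q.2)) m q.1) ∪
      ⋃ q ∈ (N ×ˢ (Finset.univ : Finset ι)).filter (fun q => q ∈ S),
        (fun p => (update p.1 q a, p.2)) '' chainPairs G g (S.erase q) m q.1 := by
  rintro ⟨f, b⟩ ⟨hf, s, c, hne, hsac, hchain⟩
  have hsS : s ∈ S := by
    by_contra h
    exact hne (hf.2.1 s h)
  have hadj := hf.1 s hsS
  have hmem : (clearSlot f s, b) ∈ chainPairs G g (S.erase s) m c :=
    ⟨clearSlot_mem_slotFillings hf s, hchain⟩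
  obtain ⟨x, i⟩ := s
  rcases Sym2.eq_iff.1 hsac with ⟨h1, h2⟩ | ⟨h1, h2⟩
  · left
    dsimp only at h1 hadj
    subst h1 h2
    refine Set.mem_biUnion (x := (f (x, i), i)) ?_ ⟨_, hmem, ?_⟩
    · simpa [hN] using ⟨hadj, hsS⟩
    · simp [update_clearSlot]
  · right
    dsimp only at h1 hadj
    subst h1
    refine Set.mem_biUnion (x := (x, i)) ?_ ⟨_, hmem, ?_⟩
    · simpa [hN, ← h2] using ⟨hadj.symm, hsS⟩
    · simp [← h2, update_clearSlot]

theorem mul_ncard_biUnion_le {α β : Type*} {J : Finset α} {A : α → Set β} {D n K : ℕ}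
    (hJ : J.card ≤ n) (hA : ∀ j ∈ J, D * (A j).ncard ≤ K) :
    D * (⋃ j ∈ J, A j).ncard ≤ n * K :=
  calc D * (⋃ j ∈ J, A j).ncard ≤ D * ∑ j ∈ J, (A j).ncard :=
        Nat.mul_le_mul_left _ (J.set_ncard_biUnion_le A)
    _ = ∑ j ∈ J, D * (A j).ncard := Finset.mul_sum _ _ _
    _ ≤ J.card • K := Finset.sum_le_card_nsmul _ _ _ hA
    _ ≤ n * K := Nat.mul_le_mul_right _ hJ

theorem chainPairs_bound [Fintype ι] {D : ℕ} (hD : 0 < D)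
    (hreg : ∀ x, (G.neighborSet x).ncard = D) (m : ℕ) : ∀ (S : Finset (V × ι)) (a : V),
    (∀ T ⊆ S, ∀ t ∈ T,
      D * (slotFillings G g (T.erase t)).ncard ≤ 2 * (slotFillings G g T).ncard) →
    (chainPairs G g S m a).Finite ∧
      (chainPairs G g S m a).ncard ≤ (4 * Fintype.card ι) ^ m * (slotFillings G g S).ncard := by
  have hfin : ∀ x, (G.neighborSet x).Finite := fun x =>
    Set.finite_of_ncard_pos (by rw [hreg x]; exact hD)
  induction m with
  | zero =>
    intro S a _
    have hsub : chainPairs G g S 0 a ⊆ (fun f => (f, a)) '' slotFillings G g S := by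
      rintro ⟨f, b⟩ ⟨hf, rfl⟩
      exact ⟨f, hf, rfl⟩
    have hS := finite_slotFillings (g := g) hfin S
    refine ⟨(hS.image _).subset hsub, ?_⟩
    rw [pow_zero, one_mul]
    exact (Set.ncard_le_ncard hsub (hS.image _)).trans (Set.ncard_image_le hS)
  | succ m ih =>
    intro S a hS
    have hN : ∀ v, v ∈ (hfin a).toFinset ↔ G.Adj a v := fun v => by simp
    have hNcard : (hfin a).toFinset.card = D := by
      rw [← Set.ncard_eq_toFinset_card _ (hfin a), hreg a]
    have hprod : ((hfin a).toFinset ×ˢ (Finset.univ : Finset ι)).card = D * Fintype.card ι := by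
      rw [Finset.card_product, hNcard, Finset.card_univ]
    have ih' (t : V × ι) (c : V) := ih (S.erase t) c
      fun T hT => hS T (hT.trans (Finset.erase_subset _ _))
    have hpiece (t : V × ι) (ht : t ∈ S) (c : V) (φ : (V × ι → V) × V → (V × ι → V) × V) :
        D * (φ '' chainPairs G g (S.erase t) m c).ncard ≤
          (4 * Fintype.card ι) ^ m * (2 * (slotFillings G g S).ncard) :=
      calc D * (φ '' chainPairs G g (S.erase t) m c).ncard
          ≤ D * ((4 * Fintype.card ι) ^ m * (slotFillings G g (S.erase t)).ncard) :=
            Nat.mul_le_mul_left _ ((Set.ncard_image_le (ih' t c).1).trans (ih' t c).2)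
        _ = (4 * Fintype.card ι) ^ m * (D * (slotFillings G g (S.erase t)).ncard) := by ring
        _ ≤ _ := Nat.mul_le_mul_left _ (hS S subset_rfl t ht)
    obtain ⟨U, hsub, hU, hUcard⟩ : ∃ U, chainPairs G g S (m + 1) a ⊆ U ∧ U.Finite ∧
        D * U.ncard ≤ 2 * (D * Fintype.card ι *
          ((4 * Fintype.card ι) ^ m * (2 * (slotFillings G g S).ncard))) := by
      refine ⟨_, chainPairs_succ_subset hN, .union
        (.biUnion (Finset.finite_toSet _) fun q _ => (ih' (a, q.2) q.1).1.image _)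
        (.biUnion (Finset.finite_toSet _) fun q _ => (ih' q q.1).1.image _), ?_⟩
      refine (Nat.mul_le_mul_left D (Set.ncard_union_le _ _)).trans ?_
      rw [mul_add, two_mul]
      exact add_le_add
        (mul_ncard_biUnion_le ((Finset.card_filter_le _ _).trans hprod.le)
          fun q hq => hpiece (a, q.2) (Finset.mem_filter.1 hq).2 _ _)
        (mul_ncard_biUnion_le ((Finset.card_filter_le _ _).trans hprod.le)
          fun q hq => hpiece q (Finset.mem_filter.1 hq).2 _ _)
    refine ⟨hU.subset hsub, Nat.le_of_mul_le_mul_left ?_ hD⟩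
    refine (Nat.mul_le_mul_left D (Set.ncard_le_ncard hsub hU)).trans (hUcard.trans_eq ?_)
    ring

/-- Adding one slot multiplies the number of fillings by at least `D / 2`. -/
theorem slotFillings_growth [Fintype ι] {D : ℕ} (hD : 0 < D)
    (hreg : ∀ x, (G.neighborSet x).ncard = D)
    (hbound : 2 * ∑ m ∈ Finset.range (g - 1), (4 * Fintype.card ι) ^ m ≤ D)
    (S : Finset (V × ι)) : ∀ t ∈ S,
      D * (slotFillings G g (S.erase t)).ncard ≤ 2 * (slotFillings G g S).ncard := by
  have hfin : ∀ x, (G.neighborSet x).Finite := fun x =>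
    Set.finite_of_ncard_pos (by rw [hreg x]; exact hD)
  induction S using Finset.strongInduction with
  | H S ih =>
    intro t ht
    set R := S.erase t with hR
    have htR : t ∉ R := Finset.notMem_erase t S
    have hchain (m : ℕ) := chainPairs_bound (g := g) hD hreg m R t.1
      fun T hT => ih T (hT.trans_ssubset (Finset.erase_ssubset ht))
    set φ : (V × ι → V) × V → V × ι → V := fun p => update p.1 t p.2
    set P := slotFillings G g R ×ˢ G.neighborSet t.1 with hP
    have hcover : P ⊆ (P ∩ φ ⁻¹' slotFillings G g S) ∪
        ⋃ m ∈ Finset.range (g - 1), chainPairs G g R m t.1 := by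
      rintro ⟨f, v⟩ ⟨hf, hv⟩
      by_cases hgood : NoShortCycle g (update f t v)
      · refine Or.inl ⟨⟨hf, hv⟩, fun s hs => ?_, fun s hs => ?_, hgood⟩
        · by_cases hst : s = t
          · subst hst
            simpa [φ] using hv
          · simpa [φ, hst] using hf.1 s (Finset.mem_erase.2 ⟨hst, hs⟩)
        · have hst : s ≠ t := fun h => hs (h ▸ ht)
          simpa [φ, hst] using hf.2.1 s fun h => hs (Finset.mem_of_mem_erase h)
      · obtain ⟨m, hm, hc⟩ := exists_slotChain_of_update hf.2.2 (hf.2.1 t htR) hgood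
        exact Or.inr (Set.mem_biUnion (Finset.mem_coe.2 (Finset.mem_range.2 hm)) ⟨hf, hc⟩)
    have hinj : Set.InjOn φ (P ∩ φ ⁻¹' slotFillings G g S) := by
      rintro ⟨f, v⟩ ⟨⟨hf, -⟩, -⟩ ⟨f', v'⟩ ⟨⟨hf', -⟩, -⟩ heq
      have hval (s : V × ι) : update f t v s = update f' t v' s := congrFun heq s
      refine Prod.ext (funext fun s => ?_) (by simpa using hval t)
      by_cases hst : s = t
      · rw [hst, hf.2.1 t htR, hf'.2.1 t htR]
      · simpa [hst] using hval s
    have hPfin : P.Finite := (finite_slotFillings hfin R).prod (hfin t.1)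
    have hcard : P.ncard = (slotFillings G g R).ncard * D := by
      rw [hP, Set.ncard_prod, hreg]
    have hgoodcard : (P ∩ φ ⁻¹' slotFillings G g S).ncard ≤ (slotFillings G g S).ncard :=
      Set.ncard_le_ncard_of_injOn φ (fun p hp => hp.2) hinj (finite_slotFillings hfin S)
    have hbad : (⋃ m ∈ Finset.range (g - 1), chainPairs G g R m t.1).ncard ≤
        (∑ m ∈ Finset.range (g - 1), (4 * Fintype.card ι) ^ m) * (slotFillings G g R).ncard := by
      rw [Finset.sum_mul]
      exact (Finset.set_ncard_biUnion_le _ _).trans (Finset.sum_le_sum fun m _ => (hchain m).2)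
    have hle := (Set.ncard_le_ncard hcover ((hPfin.subset Set.inter_subset_left).union
      (Set.Finite.biUnion (Finset.finite_toSet _) fun m _ => (hchain m).1))).trans
      (Set.ncard_union_le _ _)
    nlinarith [Nat.mul_le_mul_right (slotFillings G g R).ncard hbound]

theorem nonempty_slotFillings [Fintype ι] {D : ℕ} (hD : 0 < D)
    (hreg : ∀ x, (G.neighborSet x).ncard = D)
    (hbound : 2 * ∑ m ∈ Finset.range (g - 1), (4 * Fintype.card ι) ^ m ≤ D)
    (S : Finset (V × ι)) : (slotFillings G g S).Nonempty := by
  suffices 0 < (slotFillings G g S).ncard from Set.nonempty_of_ncard_ne_zero this.ne'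
  induction S using Finset.induction_on with
  | empty => simp [slotFillings_empty]
  | insert s S hs ih =>
    have hgrow := slotFillings_growth hD hreg hbound (insert s S) s (Finset.mem_insert_self _ _)
    rw [Finset.erase_insert hs] at hgrow
    have := Nat.mul_pos hD ih
    omega

theorem exists_noShortCycle_filling [Fintype ι] {D : ℕ} (hD : 0 < D)
    (hreg : ∀ x, (G.neighborSet x).ncard = D)
    (hbound : 2 * ∑ m ∈ Finset.range (g - 1), (4 * Fintype.card ι) ^ m ≤ D) :
    ∃ f : V × ι → V, (∀ s, G.Adj s.1 (f s)) ∧ NoShortCycle g f := by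
  have hfin : ∀ x, (G.neighborSet x).Finite := fun x =>
    Set.finite_of_ncard_pos (by rw [hreg x]; exact hD)
  choose F hF using nonempty_slotFillings (G := G) (g := g) (ι := ι) hD hreg hbound
  have : ∀ s : V × ι, Finite (G.neighborSet s.1) := fun s => hfin s.1
  obtain ⟨χ, hχ⟩ := Finset.rado_selection_subtype (β := fun s : V × ι => G.neighborSet s.1)
    fun S s => ⟨F S s, (hF S).1 s s.2⟩
  refine ⟨fun s => χ s, fun s => (χ s).2, fun s hs w => ?_⟩
  obtain ⟨S, hS⟩ := exists_finset_walk_of_agree w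
  obtain ⟨T, hST, hT⟩ := hχ (insert s S)
  have hagree (t : V × ι) (ht : t ∈ insert s S) : F T t = χ t :=
    (congrArg Subtype.val (hT ⟨t, ht⟩)).symm
  have hs' := hagree s (Finset.mem_insert_self _ _)
  obtain ⟨w', hw'⟩ := hS (clearSlot (F T) s) fun t ht => by
    by_cases hts : t = s
    · simp [hts, clearSlot]
    · simpa [clearSlot, hts] using hagree t (Finset.mem_insert_of_mem ht)
  have := (hF T).2.2 s (hs'.trans_ne hs) (w'.copy rfl hs'.symm)
  rwa [Walk.length_copy, hw'] at this

end Slots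

/-- If `d, D, g` are positive integers with `D > (12d)^g` and `G` is a
countable `D`-regular simple graph, then `G` has a spanning subgraph with minimum degree at
least `d` and girth at least `g`. -/
theorem regular_thomassen_spanning
    {V : Type*} [Countable V] (G : SimpleGraph V) (d D g : ℕ)
    (hd : 0 < d) (hD : 0 < D) (hg : 0 < g)
    (hDd : (12 * d) ^ g < D)
    (hreg : ∀ x : V, (G.neighborSet x).ncard = D) :
    ∃ H : SimpleGraph V, H ≤ G ∧ (g : ℕ∞) ≤ H.egirth ∧
      ∀ x : V, d ≤ (H.neighborSet x).ncard := by
  classical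
  rcases Nat.lt_or_ge g 3 with hg3 | hg3
  · refine ⟨G, le_rfl, le_trans (by exact_mod_cast hg3.le) G.three_le_egirth, fun x => ?_⟩
    have := Nat.le_self_pow hg.ne' (12 * d)
    rw [hreg]
    omega
  · have hbound : 2 * ∑ m ∈ Finset.range (g - 1), (4 * Fintype.card (Fin d)) ^ m ≤ D := by
      rw [Fintype.card_fin]
      have hgeom : ∑ m ∈ Finset.range (g - 1), (4 * d) ^ m < (4 * d) ^ (g - 1) :=
        Nat.geomSum_lt (by omega) fun m hm => Finset.mem_range.1 hm
      calc 2 * ∑ m ∈ Finset.range (g - 1), (4 * d) ^ m ≤ 12 * d * (12 * d) ^ (g - 1) :=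
            Nat.mul_le_mul (by omega) (hgeom.le.trans (Nat.pow_le_pow_left (by omega) _))
        _ = (12 * d) ^ g := mul_pow_sub_one hg.ne' _
        _ ≤ D := hDd.le
    obtain ⟨f, hfG, hf⟩ := exists_noShortCycle_filling (G := G) (g := g) hD hreg hbound
    have hle : slotGraph f ≤ G := by
      rintro a b ⟨-, s, hs⟩
      have : s(s.1, f s) ∈ G.edgeSet := hfG s
      rwa [hs] at this
    refine ⟨slotGraph f, hle, le_egirth_slotGraph hf, fun x => ?_⟩
    have hinj := hf.injective hg3 (fun s => (hfG s).ne') x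
    have hsub : Set.range (fun i => f (x, i)) ⊆ (slotGraph f).neighborSet x := by
      rintro _ ⟨i, rfl⟩
      exact ⟨(hfG (x, i)).ne, (x, i), rfl⟩
    have hfin : (G.neighborSet x).Finite := Set.finite_of_ncard_pos (by rw [hreg x]; exact hD)
    calc d = (Set.range fun i => f (x, i)).ncard := by
          rw [Set.ncard_range_of_injective hinj, Nat.card_fin]
      _ ≤ _ := Set.ncard_le_ncard hsub (hfin.subset fun _ hy => hle hy)
end

section
/- Let G be a countable, loopless, undirected graph with finite maximum degree and with minimum degree at least δ, where δ is a positive integer. Then G has a spanning 2-Lipschitz subgraph H with girth at least g(G)/2, minimum degree at least δ, and maximum degree at most δ + 1. -/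
open SimpleGraph

/-- `H` is an `L`-Lipschitz subgraph of `G` (on the same vertex set, hence spanning):
the endpoints of every edge of `H` are at distance at most `L` in `G`. -/
def IsLipschitzSubgraph {V : Type*} (G H : SimpleGraph V) (L : ℕ) : Prop :=
  ∀ x y : V, H.Adj x y → G.Reachable x y ∧ G.dist x y ≤ L

/-- A totally ordered nonempty family of finite sets has a least member. -/
lemma exists_subset_of_finite_of_total {ι V : Type*} (c : Set ι) (hc : c.Nonempty)
    (S : ι → Set V) (hfin : ∀ a ∈ c, (S a).Finite)
    (htotal : ∀ a ∈ c, ∀ b ∈ c, S a ⊆ S b ∨ S b ⊆ S a) :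
    ∃ a ∈ c, ∀ b ∈ c, S a ⊆ S b := by
  obtain ⟨a, hac, ha⟩ :=
    (measure fun a => (S a).ncard).wf.has_min c hc
  refine ⟨a, hac, fun b hb => (htotal a hac b hb).elim id fun hba => ?_⟩
  exact (Set.eq_of_subset_of_ncard_le hba (not_lt.1 (ha b hb)) (hfin a hac)).ge

/-- A locally finite graph of minimum degree at least `δ` has a spanning subgraph of minimum
degree at least `δ` in which the vertices of degree larger than `δ` are independent. -/
lemma exists_le_minDegree_independent {V : Type*} (G : SimpleGraph V) (δ : ℕ)
    (hfin : ∀ v, (G.neighborSet v).Finite) (hdeg : ∀ v, δ ≤ (G.neighborSet v).ncard) :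
    ∃ H ≤ G, (∀ v, δ ≤ (H.neighborSet v).ncard) ∧
      ∀ v w, H.Adj v w → δ < (H.neighborSet v).ncard → (H.neighborSet w).ncard = δ := by
  let S : Set (SimpleGraph V) := {H | H ≤ G ∧ ∀ v, δ ≤ (H.neighborSet v).ncard}
  have hsub : ∀ {H K : SimpleGraph V}, H ≤ K → ∀ v, H.neighborSet v ⊆ K.neighborSet v :=
    fun h _ _ hw => h hw
  have hchain : ∀ c ⊆ S, IsChain (· ≤ ·) c → ∀ K ∈ c, sInf c ∈ S := by
    intro c hcS hc K hK
    refine ⟨(sInf_le hK).trans (hcS hK).1, fun v => ?_⟩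
    obtain ⟨A, hA, hmin⟩ := exists_subset_of_finite_of_total c ⟨K, hK⟩
      (fun A : SimpleGraph V => A.neighborSet v)
      (fun A hA => (hfin v).subset (hsub (hcS hA).1 v))
      (fun A hA B hB => (hc.total hA hB).imp (fun h => hsub h v) (fun h => hsub h v))
    have heq : (sInf c).neighborSet v = A.neighborSet v :=
      (hsub (sInf_le hA) v).antisymm fun w hw =>
        (SimpleGraph.sInf_adj_of_nonempty ⟨K, hK⟩).2 fun B hB => hmin B hB hw
    rw [heq]
    exact (hcS hA).2 v
  obtain ⟨H, hH⟩ : ∃ H : SimpleGraph V, Minimal (· ∈ S) H := by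
    obtain ⟨H, -, hH⟩ := @zorn_le_nonempty₀ (SimpleGraph V)ᵒᵈ _ S
      (fun c hcS hc K hK => ⟨sInf (α := SimpleGraph V) c, hchain c hcS hc.symm K hK,
        fun _ hz => sInf_le (α := SimpleGraph V) hz⟩) G ⟨le_rfl, hdeg⟩
    exact ⟨H, hH⟩
  have hHS : H ∈ S := hH.prop
  refine ⟨H, hHS.1, hHS.2, fun v w hvw hv => (hHS.2 w).antisymm' ?_⟩
  by_contra! hw
  let K : SimpleGraph V := H.deleteEdges {s(v, w)}
  have hKH : K ≤ H := H.deleteEdges_le _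
  have hdiff : ∀ a b, δ < (H.neighborSet a).ncard →
      (H.neighborSet a) \ {b} ⊆ K.neighborSet a → δ ≤ (K.neighborSet a).ncard := by
    intro a b ha hab
    have h1 := Set.ncard_le_ncard hab ((hfin a).subset (hsub (hKH.trans hHS.1) a))
    have h2 := Set.pred_ncard_le_ncard_sdiff_singleton (H.neighborSet a) b
    omega
  have hK : K ∈ S := by
    refine ⟨hKH.trans hHS.1, fun u => ?_⟩
    by_cases huv : u = v
    · subst huv
      exact hdiff u w hv fun b hb => by
        simp only [K, SimpleGraph.mem_neighborSet, SimpleGraph.deleteEdges_adj,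
          Set.mem_sdiff, Set.mem_singleton_iff] at hb ⊢
        grind
    by_cases huw : u = w
    · subst huw
      exact hdiff u v hw fun b hb => by
        simp only [K, SimpleGraph.mem_neighborSet, SimpleGraph.deleteEdges_adj,
          Set.mem_sdiff, Set.mem_singleton_iff] at hb ⊢
        grind
    have : K.neighborSet u = H.neighborSet u := by
      ext b
      simp only [K, SimpleGraph.mem_neighborSet, SimpleGraph.deleteEdges_adj,
        Set.mem_singleton_iff]
      grind
    rw [this]
    exact hHS.2 u
  have hHK : H ≤ K := hH.le_of_le hK hKH
  simpa [K] using hHK hvw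

/-- If the edges of `H` can be replaced by walks of length one or two in `G` that are pairwise
edge-disjoint, then a trail in `H` can be replaced by a trail in `G` at most twice as long. -/
lemma exists_trail_of_edge_expansion {V : Type*} {G H : SimpleGraph V}
    (R : Sym2 V → Sym2 V → Prop) (hR : ∀ f f' e, R f e → R f' e → f = f')
    (hexp : ∀ a b, H.Adj a b → ∃ q : G.Walk a b, q.IsTrail ∧ 1 ≤ q.length ∧ q.length ≤ 2 ∧
      ∀ e ∈ q.edges, R s(a, b) e) {u v : V} (p : H.Walk u v) (hp : p.IsTrail) :
    ∃ q : G.Walk u v, q.IsTrail ∧ p.length ≤ q.length ∧ q.length ≤ 2 * p.length ∧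
      ∀ e ∈ q.edges, ∃ f ∈ p.edges, R f e := by
  induction p with
  | nil => exact ⟨.nil, by simp⟩
  | cons h p ih =>
    rw [SimpleGraph.Walk.isTrail_cons] at hp
    obtain ⟨q, hq, hl, hu, hqR⟩ := ih hp.1
    obtain ⟨r, hr, hl', hu', hrR⟩ := hexp _ _ h
    refine ⟨r.append q, ?_, ?_, ?_, ?_⟩
    · rw [SimpleGraph.Walk.isTrail_append]
      refine ⟨hr, hq, fun e her heq => ?_⟩
      obtain ⟨f, hf, hfe⟩ := hqR e heq
      exact hp.2 (hR _ _ _ (hrR e her) hfe ▸ hf)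
    · simp only [SimpleGraph.Walk.length_append, SimpleGraph.Walk.length_cons]
      omega
    · simp only [SimpleGraph.Walk.length_append, SimpleGraph.Walk.length_cons]
      omega
    · intro e he
      rw [SimpleGraph.Walk.edges_append, List.mem_append] at he
      rcases he with he | he
      · exact ⟨_, by simp, hrR e he⟩
      · obtain ⟨f, hf, hfe⟩ := hqR e he
        exact ⟨f, by simp [hf], hfe⟩

lemma egirth_le_two_mul_of_edge_expansion {V : Type*} {G H : SimpleGraph V}
    (R : Sym2 V → Sym2 V → Prop) (hR : ∀ f f' e, R f e → R f' e → f = f')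
    (hexp : ∀ a b, H.Adj a b → ∃ q : G.Walk a b, q.IsTrail ∧ 1 ≤ q.length ∧ q.length ≤ 2 ∧
      ∀ e ∈ q.edges, R s(a, b) e) :
    G.egirth ≤ 2 * H.egirth := by
  by_cases hH : H.IsAcyclic
  · simp [hH.egirth_eq_top]
  obtain ⟨a, p, hp, hlen⟩ := SimpleGraph.exists_egirth_eq_length.2 hH
  obtain ⟨q, hq, hl, hu, -⟩ := exists_trail_of_edge_expansion R hR hexp p hp.isTrail
  have hcirc : q.IsCircuit := ⟨hq, by
    rintro rfl
    have := hp.three_le_length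
    simp only [SimpleGraph.Walk.length_nil] at hl
    omega⟩
  rw [hlen]
  exact hcirc.egirth_le_length.trans (by exact_mod_cast hu)

/-- The neighbours `x` of `v` such that the edge `vx` is not paired at `v`, where `(v, x, y) ∈ P`
means that the edges `vx` and `vy` are paired at `v`. -/
def unpairedNeighbors {V : Type*} (G : SimpleGraph V) (P : Set (V × V × V)) (v : V) : Set V :=
  {x | G.Adj v x ∧ ∀ y, (v, x, y) ∉ P}

/-- `P` describes a pairing of edges at the vertices of degree larger than `δ`, such that
replacing the paired edges `vx`, `vy` by `xy` creates no parallel edges and no degree below `δ`. -/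
structure IsEdgePairing {V : Type*} (G : SimpleGraph V) (δ : ℕ) (P : Set (V × V × V)) : Prop where
  symm : ∀ {v x y}, (v, x, y) ∈ P → (v, y, x) ∈ P
  lt_ncard : ∀ {v x y}, (v, x, y) ∈ P → δ < (G.neighborSet v).ncard
  adj : ∀ {v x y}, (v, x, y) ∈ P → G.Adj v x
  ne : ∀ {v x y}, (v, x, y) ∈ P → x ≠ y
  not_adj : ∀ {v x y}, (v, x, y) ∈ P → ¬ G.Adj x y
  partner_unique : ∀ {v x y z}, (v, x, y) ∈ P → (v, x, z) ∈ P → y = z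
  center_unique : ∀ {v w x y}, (v, x, y) ∈ P → (w, x, y) ∈ P → v = w
  le_ncard_unpaired : ∀ v, δ ≤ (unpairedNeighbors G P v).ncard

namespace IsEdgePairing

variable {V : Type*} {G : SimpleGraph V} {δ : ℕ} {P : Set (V × V × V)}

/-- The graph obtained by replacing all paired edges `vx`, `vy` by `xy`. -/
def graph (hP : IsEdgePairing G δ P) : SimpleGraph V where
  Adj a b := (∃ v, (v, a, b) ∈ P) ∨
    (G.Adj a b ∧ (∀ y, (a, b, y) ∉ P) ∧ ∀ y, (b, a, y) ∉ P)
  symm := ⟨by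
    rintro a b (⟨v, h⟩ | ⟨h, h₁, h₂⟩)
    · exact .inl ⟨v, hP.symm h⟩
    · exact .inr ⟨h.symm, h₂, h₁⟩⟩
  loopless := ⟨by
    rintro a (⟨v, h⟩ | ⟨h, -⟩)
    · exact hP.ne h rfl
    · exact G.loopless.irrefl a h⟩

lemma neighborSet_graph_of_lt (hP : IsEdgePairing G δ P)
    (hind : ∀ v w, G.Adj v w → δ < (G.neighborSet v).ncard → (G.neighborSet w).ncard = δ)
    {v : V} (hv : δ < (G.neighborSet v).ncard) :
    hP.graph.neighborSet v = unpairedNeighbors G P v := by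
  ext b
  constructor
  · rintro (⟨w, h⟩ | ⟨h, h₁, -⟩)
    · exact absurd (hind w v (hP.adj h) (hP.lt_ncard h)) hv.ne'
    · exact ⟨h, h₁⟩
  · rintro ⟨h, h₁⟩
    exact .inr ⟨h, h₁, fun y hy => (hP.lt_ncard hy).ne' (hind v b h hv)⟩

lemma exists_injOn_image_eq_neighborSet_graph (hP : IsEdgePairing G δ P)
    {x : V} (hx : (G.neighborSet x).ncard = δ) :
    ∃ φ : V → V, Set.InjOn φ (G.neighborSet x) ∧
      φ '' G.neighborSet x = hP.graph.neighborSet x := by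
  have hex : ∀ v, ∃ y, (v, x, y) ∈ P ∨ (y = v ∧ ∀ z, (v, x, z) ∉ P) := by
    intro v
    by_cases h : ∃ y, (v, x, y) ∈ P
    · exact h.imp fun _ => .inl
    · exact ⟨v, .inr ⟨rfl, not_exists.1 h⟩⟩
  choose φ hφ using hex
  refine ⟨φ, fun v hv w hw hvw => ?_, Set.Subset.antisymm ?_ fun b hb => ?_⟩
  · rcases hφ v with h | ⟨h, -⟩ <;> rcases hφ w with h' | ⟨h', -⟩
    · exact hP.center_unique h (hvw ▸ h')
    · exact absurd (show G.Adj x (φ v) by rw [hvw, h']; exact hw) (hP.not_adj h)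
    · exact absurd (show G.Adj x (φ w) by rw [← hvw, h]; exact hv) (hP.not_adj h')
    · rw [← h, ← h', hvw]
  · rintro _ ⟨v, hv, rfl⟩
    rcases hφ v with h | ⟨h, h'⟩
    · exact .inl ⟨v, h⟩
    · rw [h]
      exact .inr ⟨hv, fun y hy => (hP.lt_ncard hy).ne' hx, h'⟩
  · rcases hb with ⟨v, h⟩ | ⟨h, -, h₂⟩
    · refine ⟨v, (hP.adj h).symm, ?_⟩
      rcases hφ v with h' | ⟨-, h'⟩
      · exact hP.partner_unique h' h
      · exact absurd h (h' b)
    · refine ⟨b, h, ?_⟩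
      rcases hφ b with h' | ⟨h', -⟩
      · exact absurd h' (h₂ _)
      · exact h'

lemma ncard_neighborSet_graph_of_eq (hP : IsEdgePairing G δ P)
    {x : V} (hx : (G.neighborSet x).ncard = δ) :
    (hP.graph.neighborSet x).ncard = δ := by
  obtain ⟨φ, hinj, himg⟩ := hP.exists_injOn_image_eq_neighborSet_graph hx
  rw [← himg, hinj.ncard_image, hx]

lemma finite_neighborSet_graph_of_eq (hP : IsEdgePairing G δ P)
    (hfin : ∀ v, (G.neighborSet v).Finite) {x : V} (hx : (G.neighborSet x).ncard = δ) :
    (hP.graph.neighborSet x).Finite := by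
  obtain ⟨φ, -, himg⟩ := hP.exists_injOn_image_eq_neighborSet_graph hx
  exact himg ▸ (hfin x).image φ

/-- The edge `f` of the new graph replaces the edge `e` of `G`. -/
def Replaces (P : Set (V × V × V)) (f e : Sym2 V) : Prop :=
  (f = e ∧ ∀ v x y, (v, x, y) ∈ P → e ≠ s(v, x)) ∨
    ∃ v x y, (v, x, y) ∈ P ∧ f = s(x, y) ∧ e = s(v, x)

lemma replaces_unique (hP : IsEdgePairing G δ P)
    (hind : ∀ v w, G.Adj v w → δ < (G.neighborSet v).ncard → (G.neighborSet w).ncard = δ)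
    (f f' e : Sym2 V) (hf : Replaces P f e) (hf' : Replaces P f' e) : f = f' := by
  rcases hf with ⟨rfl, h⟩ | ⟨v, x, y, h, rfl, rfl⟩ <;>
    rcases hf' with ⟨rfl, h'⟩ | ⟨w, x', y', h', rfl, he⟩
  · rfl
  · exact absurd he (h _ _ _ h')
  · exact absurd rfl (h' _ _ _ h)
  · rcases Sym2.eq_iff.1 he with ⟨rfl, rfl⟩ | ⟨rfl, rfl⟩
    · rw [hP.partner_unique h h']
    · exact absurd (hind _ _ (hP.adj h) (hP.lt_ncard h)) (hP.lt_ncard h').ne'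

lemma exists_walk_of_graph_adj (hP : IsEdgePairing G δ P) (a b : V) (hab : hP.graph.Adj a b) :
    ∃ q : G.Walk a b, q.IsTrail ∧ 1 ≤ q.length ∧ q.length ≤ 2 ∧
      ∀ e ∈ q.edges, Replaces P s(a, b) e := by
  rcases hab with ⟨v, h⟩ | ⟨h, h₁, h₂⟩
  · have h' := hP.symm h
    refine ⟨.cons (hP.adj h).symm (.cons (hP.adj h') .nil), ?_, by simp, by simp, ?_⟩
    · have := hP.ne h
      have := (hP.adj h).ne
      simp only [SimpleGraph.Walk.isTrail_def, SimpleGraph.Walk.edges_cons,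
        SimpleGraph.Walk.edges_nil]
      grind
    · intro e he
      simp only [SimpleGraph.Walk.edges_cons, SimpleGraph.Walk.edges_nil, List.mem_cons,
        List.not_mem_nil, or_false] at he
      rcases he with rfl | rfl
      · exact .inr ⟨v, a, b, h, rfl, Sym2.eq_swap⟩
      · exact .inr ⟨v, b, a, h', Sym2.eq_swap, rfl⟩
  · refine ⟨.cons h .nil, by simp, by simp, by simp, fun e he => .inl ⟨?_, ?_⟩⟩
    · simpa [eq_comm] using he
    · rintro v x y hv rfl
      simp only [SimpleGraph.Walk.edges_cons, SimpleGraph.Walk.edges_nil, List.mem_cons,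
        List.not_mem_nil, or_false] at he
      rcases Sym2.eq_iff.1 he with ⟨rfl, rfl⟩ | ⟨rfl, rfl⟩
      · exact h₁ _ hv
      · exact h₂ _ hv

lemma sUnion {c : Set (Set (V × V × V))} (hc : IsChain (· ⊆ ·) c) (hne : c.Nonempty)
    (hcP : ∀ P ∈ c, IsEdgePairing G δ P) (hfin : ∀ v, (G.neighborSet v).Finite) :
    IsEdgePairing G δ (⋃₀ c) where
  symm := fun ⟨P, hP, h⟩ => ⟨P, hP, (hcP P hP).symm h⟩
  lt_ncard := fun ⟨P, hP, h⟩ => (hcP P hP).lt_ncard h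
  adj := fun ⟨P, hP, h⟩ => (hcP P hP).adj h
  ne := fun ⟨P, hP, h⟩ => (hcP P hP).ne h
  not_adj := fun ⟨P, hP, h⟩ => (hcP P hP).not_adj h
  partner_unique := fun ⟨P, hP, h⟩ ⟨Q, hQ, h'⟩ => (hc.total hP hQ).elim
    (fun hPQ => (hcP Q hQ).partner_unique (hPQ h) h')
    (fun hQP => (hcP P hP).partner_unique h (hQP h'))
  center_unique := fun ⟨P, hP, h⟩ ⟨Q, hQ, h'⟩ => (hc.total hP hQ).elim
    (fun hPQ => (hcP Q hQ).center_unique (hPQ h) h')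
    (fun hQP => (hcP P hP).center_unique h (hQP h'))
  le_ncard_unpaired := fun v => by
    have hsub : ∀ {P Q : Set (V × V × V)}, P ⊆ Q →
        unpairedNeighbors G Q v ⊆ unpairedNeighbors G P v :=
      fun h _ hx => ⟨hx.1, fun y hy => hx.2 y (h hy)⟩
    obtain ⟨P, hP, hmin⟩ := exists_subset_of_finite_of_total c hne
      (fun P => unpairedNeighbors G P v) (fun P _ => (hfin v).subset fun _ hx => hx.1)
      (fun P hP Q hQ => (hc.total hP hQ).symm.imp hsub hsub)
    have heq : unpairedNeighbors G (⋃₀ c) v = unpairedNeighbors G P v :=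
      (hsub (Set.subset_sUnion_of_mem hP)).antisymm fun x hx =>
        ⟨hx.1, fun y ⟨Q, hQ, h⟩ => (hmin Q hQ hx).2 y h⟩
    rw [heq]
    exact (hcP P hP).le_ncard_unpaired v

/-- If too many edges at `v` are unpaired, then the pairing can be extended. -/
lemma exists_ssuperset (hP : IsEdgePairing G δ P) (hfin : ∀ v, (G.neighborSet v).Finite)
    (hind : ∀ v w, G.Adj v w → δ < (G.neighborSet v).ncard → (G.neighborSet w).ncard = δ)
    {v : V} (hv : δ + 1 < (unpairedNeighbors G P v).ncard) :
    ∃ Q, IsEdgePairing G δ Q ∧ P ⊂ Q := by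
  have hvbig : δ < (G.neighborSet v).ncard :=
    (Nat.lt_of_succ_lt hv).trans_le (Set.ncard_le_ncard (fun _ hx => hx.1) (hfin v))
  obtain ⟨x, hx⟩ : (unpairedNeighbors G P v).Nonempty :=
    Set.nonempty_of_ncard_ne_zero (by omega)
  have hxdeg := hind v x hx.1 hvbig
  obtain ⟨y, ⟨hy, hyx⟩, hxy⟩ : ∃ y ∈ unpairedNeighbors G P v \ {x},
      y ∉ hP.graph.neighborSet x := by
    apply Set.exists_mem_notMem_of_ncard_lt_ncard _
      (hP.finite_neighborSet_graph_of_eq hfin hxdeg)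
    have := Set.pred_ncard_le_ncard_sdiff_singleton (unpairedNeighbors G P v) x
    rw [hP.ncard_neighborSet_graph_of_eq hxdeg]
    omega
  have hydeg := hind v y hy.1 hvbig
  have hne : x ≠ y := fun h => hyx h.symm
  have hnew : ∀ w, (w, x, y) ∉ P := fun w h => hxy (.inl ⟨w, h⟩)
  have hnew_symm : ∀ w, (w, y, x) ∉ P := fun w h => hnew w (hP.symm h)
  have hxyG : ¬ G.Adj x y := fun h => hxy <| .inr
    ⟨h, fun _ hz => (hP.lt_ncard hz).ne' hxdeg, fun _ hz => (hP.lt_ncard hz).ne' hydeg⟩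
  have hmem : ∀ {w a b}, (w, a, b) ∈ P ∪ {(v, x, y), (v, y, x)} ↔
      (w, a, b) ∈ P ∨ (w = v ∧ a = x ∧ b = y) ∨ (w = v ∧ a = y ∧ b = x) := by
    intro w a b
    simp only [Set.mem_union, Set.mem_insert_iff, Set.mem_singleton_iff, Prod.mk.injEq]
  refine ⟨P ∪ {(v, x, y), (v, y, x)}, ⟨?_, ?_, ?_, ?_, ?_, ?_, ?_, ?_⟩,
    Set.subset_union_left, fun h => hnew v (h (hmem.2 (by simp)))⟩
  · intro w a b h
    rw [hmem] at h ⊢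
    have := @hP.symm w a b
    tauto
  · intro w a b h
    rcases hmem.1 h with h | ⟨rfl, -⟩ | ⟨rfl, -⟩
    exacts [hP.lt_ncard h, hvbig, hvbig]
  · intro w a b h
    rcases hmem.1 h with h | ⟨rfl, rfl, -⟩ | ⟨rfl, rfl, -⟩
    exacts [hP.adj h, hx.1, hy.1]
  · intro w a b h
    rcases hmem.1 h with h | ⟨-, rfl, rfl⟩ | ⟨-, rfl, rfl⟩
    exacts [hP.ne h, hne, hne.symm]
  · intro w a b h
    rcases hmem.1 h with h | ⟨-, rfl, rfl⟩ | ⟨-, rfl, rfl⟩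
    exacts [hP.not_adj h, hxyG, fun h => hxyG h.symm]
  · intro w a b d h h'
    have h₁ := hx.2
    have h₂ := hy.2
    rw [hmem] at h h'
    rcases h with h | ⟨rfl, rfl, rfl⟩ | ⟨rfl, rfl, rfl⟩ <;>
      rcases h' with h' | ⟨h3, h4, h5⟩ | ⟨h3, h4, h5⟩
    · exact hP.partner_unique h h'
    all_goals grind
  · intro w w' a b h h'
    rw [hmem] at h h'
    rcases h with h | ⟨rfl, rfl, rfl⟩ | ⟨rfl, rfl, rfl⟩ <;>
      rcases h' with h' | ⟨h3, h4, h5⟩ | ⟨h3, h4, h5⟩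
    · exact hP.center_unique h h'
    all_goals grind
  · intro w
    by_cases hw : w = v
    · subst hw
      have hsub : (unpairedNeighbors G P w \ {x}) \ {y} ⊆
          unpairedNeighbors G (P ∪ {(w, x, y), (w, y, x)}) w := by
        rintro a ⟨⟨ha, hax⟩, hay⟩
        refine ⟨ha.1, fun b hb => ?_⟩
        rcases hmem.1 hb with h | ⟨-, h, -⟩ | ⟨-, h, -⟩
        exacts [ha.2 b h, hax h, hay h]
      have h₁ := Set.ncard_le_ncard hsub ((hfin w).subset fun _ hx => hx.1)
      have h₂ := Set.pred_ncard_le_ncard_sdiff_singleton (unpairedNeighbors G P w) x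
      have h₃ := Set.pred_ncard_le_ncard_sdiff_singleton (unpairedNeighbors G P w \ {x}) y
      omega
    · refine (hP.le_ncard_unpaired w).trans (Set.ncard_le_ncard (fun a ha => ⟨ha.1, fun b hb => ?_⟩)
        ((hfin w).subset fun _ hx => hx.1))
      rcases hmem.1 hb with h | ⟨h, -⟩ | ⟨h, -⟩
      exacts [ha.2 b h, hw h, hw h]

end IsEdgePairing

/-- There is an edge pairing leaving at most `δ + 1` edges unpaired at each vertex. -/
lemma exists_isEdgePairing_ncard_unpaired_le {V : Type*} (G : SimpleGraph V) (δ : ℕ)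
    (hfin : ∀ v, (G.neighborSet v).Finite) (hdeg : ∀ v, δ ≤ (G.neighborSet v).ncard)
    (hind : ∀ v w, G.Adj v w → δ < (G.neighborSet v).ncard → (G.neighborSet w).ncard = δ) :
    ∃ P, IsEdgePairing G δ P ∧ ∀ v, (unpairedNeighbors G P v).ncard ≤ δ + 1 := by
  have hempty : IsEdgePairing G δ (∅ : Set (V × V × V)) := by
    refine ⟨?_, ?_, ?_, ?_, ?_, ?_, ?_, fun v => ?_⟩
    case refine_8 =>
      have : unpairedNeighbors G ∅ v = G.neighborSet v := by
        ext x
        simp [unpairedNeighbors]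
      exact this ▸ hdeg v
    all_goals simp
  obtain ⟨P, -, hP⟩ := zorn_subset_nonempty {P | IsEdgePairing G δ P}
    (fun c hcP hc hne => ⟨⋃₀ c, IsEdgePairing.sUnion hc hne hcP hfin,
      fun _ h => Set.subset_sUnion_of_mem h⟩) ∅ hempty
  refine ⟨P, hP.prop, fun v => ?_⟩
  by_contra! hv
  obtain ⟨Q, hQ, hPQ⟩ := IsEdgePairing.exists_ssuperset hP.prop hfin hind hv
  exact hPQ.2 (hP.le_of_ge hQ hPQ.1)

/-- Let `G` be a countable (loopless, undirected) graph with finite maximum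
degree and minimum degree at least `δ > 0`. Then `G` has a spanning `2`-Lipschitz subgraph
`H` with girth at least `g(G)/2` (i.e. `g(G) ≤ 2 * g(H)`), minimum degree at least `δ` and
maximum degree at most `δ + 1`. -/
theorem spanning_two_lipschitz_almost_regular
    {V : Type*} [Countable V] (G : SimpleGraph V) (δ : ℕ) (hδpos : 0 < δ)
    (hmaxdeg : ∃ Δ : ℕ, ∀ v : V, (G.neighborSet v).Finite ∧ (G.neighborSet v).ncard ≤ Δ)
    (hmindeg : ∀ v : V, δ ≤ (G.neighborSet v).ncard) :
    ∃ H : SimpleGraph V,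
      IsLipschitzSubgraph G H 2 ∧
      G.egirth ≤ 2 * H.egirth ∧
      (∀ v : V, δ ≤ (H.neighborSet v).ncard) ∧
      (∀ v : V, (H.neighborSet v).ncard ≤ δ + 1) := by
  obtain ⟨Δ, hΔ⟩ := hmaxdeg
  obtain ⟨K, hKG, hKdeg, hind⟩ :=
    exists_le_minDegree_independent G δ (fun v => (hΔ v).1) hmindeg
  have hfin : ∀ v, (K.neighborSet v).Finite := fun v => (hΔ v).1.subset fun _ h => hKG h
  obtain ⟨P, hP, hPle⟩ := exists_isEdgePairing_ncard_unpaired_le K δ hfin hKdeg hind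
  refine ⟨hP.graph, fun x y hxy => ?_, ?_, fun v => ?_, fun v => ?_⟩
  · obtain ⟨q, -, -, hq, -⟩ := hP.exists_walk_of_graph_adj x y hxy
    refine ⟨(q.mapLe hKG).reachable, (SimpleGraph.dist_le (q.mapLe hKG)).trans ?_⟩
    simpa using hq
  · exact (SimpleGraph.egirth_anti hKG).trans <| egirth_le_two_mul_of_edge_expansion _
      (hP.replaces_unique hind) hP.exists_walk_of_graph_adj
  · rcases (hKdeg v).eq_or_lt with h | h
    · exact (hP.ncard_neighborSet_graph_of_eq h.symm).ge
    · exact hP.neighborSet_graph_of_lt hind h ▸ hP.le_ncard_unpaired v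
  · rcases (hKdeg v).eq_or_lt with h | h
    · exact (hP.ncard_neighborSet_graph_of_eq h.symm).le.trans (Nat.le_succ δ)
    · exact hP.neighborSet_graph_of_lt hind h ▸ hPle v
end

section
/- Let δ ≥ 4 be an even integer and let G be a finite graph with minimum degree δ and maximum degree at most δ + 1, such that no two adjacent vertices both have degree δ + 1. Then G has a δ-regular spanning 3-Lipschitz subgraph H with girth at least g(G)/3. -/
open SimpleGraph

namespace SimpleGraph

variable {V : Type*}

/-- An edge together with a walk joining its ends and avoiding it bounds the girth. -/
lemma egirth_le_of_notMem_edges {G : SimpleGraph V} {a c : V} (hac : G.Adj a c)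
    (W : G.Walk c a) (hW : s(a, c) ∉ W.edges) : G.egirth ≤ (W.length + 1 : ℕ) := by
  classical
  have hcyc : (Walk.cons hac W.bypass).IsCycle :=
    (Walk.cons_isCycle_iff _ _).2 ⟨W.bypass_isPath, fun h => hW (W.edges_bypass_subset_edges h)⟩
  refine (egirth_le_length hcyc).trans ?_
  have := W.length_bypass_le_length
  simp only [Walk.length_cons]
  exact_mod_cast Nat.add_le_add_right this 1

/-- `H` arises from `G` by replacing each base edge `b e` by a short detour through it whose other
edges are heavier than `b e`. -/
def IsWeightedDetour (G H : SimpleGraph V) (b : Sym2 V → Sym2 V) (wt : Sym2 V → ℕ) : Prop :=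
  ∀ u v, H.Adj u v → ∃ a c, G.Adj a c ∧ b s(u, v) = s(a, c) ∧
    ∃ (P : G.Walk u a) (Q : G.Walk c v), P.length + Q.length ≤ 2 ∧
      ∀ e, e ∈ P.edges ∨ e ∈ Q.edges → wt s(a, c) < wt e

namespace IsWeightedDetour

variable {G H : SimpleGraph V} {b : Sym2 V → Sym2 V} {wt : Sym2 V → ℕ}

lemma exists_walk (h : IsWeightedDetour G H b wt) {f : Sym2 V} {u v : V} (W : H.Walk u v)
    (hW : ∀ e ∈ W.edges, b e ≠ f ∧ wt f ≤ wt (b e)) :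
    ∃ P : G.Walk u v, P.length ≤ 3 * W.length ∧ f ∉ P.edges := by
  induction W with
  | nil => exact ⟨Walk.nil, by simp⟩
  | @cons u w v huv W ih =>
    obtain ⟨R, hR, hfR⟩ := ih fun e he => hW e (by simp [he])
    obtain ⟨hne, hle⟩ := hW s(u, w) (by simp)
    obtain ⟨a, c, hac, hb, P, Q, hPQ, hwt⟩ := h _ _ huv
    rw [hb] at hne hle
    refine ⟨P.append (Walk.cons hac (Q.append R)), ?_, ?_⟩
    · simp only [Walk.length_append, Walk.length_cons]
      lia
    · simp only [Walk.edges_append, Walk.edges_cons, List.mem_append, List.mem_cons, not_or]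
      refine ⟨fun hf => ?_, hne.symm, fun hf => ?_, hfR⟩
      · exact (hwt f (.inl hf)).not_ge hle
      · exact (hwt f (.inr hf)).not_ge hle

lemma exists_walks_around (h : IsWeightedDetour G H b wt) (hb : Set.InjOn b H.edgeSet)
    {e₀ : Sym2 V} {u v : V} (W : H.Walk u v) (hW : W.IsTrail) (he₀ : e₀ ∈ W.edges)
    (hmin : ∀ e ∈ W.edges, wt (b e₀) ≤ wt (b e)) :
    ∃ a c, G.Adj a c ∧ b e₀ = s(a, c) ∧ ∃ (P : G.Walk u a) (Q : G.Walk c v),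
      P.length + Q.length + 1 ≤ 3 * W.length ∧ b e₀ ∉ P.edges ∧ b e₀ ∉ Q.edges := by
  have hinj : ∀ e ∈ W.edges, e ≠ e₀ → b e ≠ b e₀ := fun e he hne heq =>
    hne (hb (W.edges_subset_edgeSet he) (W.edges_subset_edgeSet he₀) heq)
  induction W with
  | nil => simp at he₀
  | @cons u w v huv W ih =>
    rw [Walk.isTrail_cons] at hW
    obtain ⟨a, c, hac, hbac, P, Q, hPQ, hwt⟩ := h _ _ huv
    by_cases heq : e₀ = s(u, w)
    · obtain ⟨R, hR, hfR⟩ := h.exists_walk (f := b e₀) W fun e he =>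
        ⟨hinj e (by simp [he]) (by rintro rfl; exact hW.2 (heq ▸ he)), hmin e (by simp [he])⟩
      subst heq
      rw [hbac] at hfR ⊢
      refine ⟨a, c, hac, rfl, P, Q.append R, ?_, ?_, ?_⟩
      · simp only [Walk.length_append, Walk.length_cons]
        lia
      · exact fun hf => (hwt _ (.inl hf)).false
      · simp only [Walk.edges_append, List.mem_append, not_or]
        exact ⟨fun hf => (hwt _ (.inr hf)).false, hfR⟩
    · have he₀' : e₀ ∈ W.edges := by simpa [heq] using he₀
      obtain ⟨a', c', hac', hb', P', Q', hlen, hP', hQ'⟩ := ih hW.1 he₀'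
        (fun e he => hmin e (by simp [he])) (fun e he => hinj e (by simp [he]))
      have hne := hinj s(u, w) (by simp) (Ne.symm heq)
      have hle := hmin s(u, w) (by simp)
      rw [hbac] at hne hle
      refine ⟨a', c', hac', hb', P.append (Walk.cons hac (Q.append P')), Q', ?_, ?_, hQ'⟩
      · simp only [Walk.length_append, Walk.length_cons]
        lia
      · simp only [Walk.edges_append, Walk.edges_cons, List.mem_append, List.mem_cons, not_or]
        exact ⟨fun hf => (hwt _ (.inl hf)).not_ge hle, hne.symm,
          fun hf => (hwt _ (.inr hf)).not_ge hle, hP'⟩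

lemma egirth_le (h : IsWeightedDetour G H b wt) (hb : Set.InjOn b H.edgeSet) :
    G.egirth ≤ 3 * H.egirth := by
  classical
  by_cases hH : H.IsAcyclic
  · simp [egirth_eq_top.2 hH]
  obtain ⟨x, W, hW, hlen⟩ := exists_egirth_eq_length.2 hH
  obtain ⟨e₀, he₀, hmin⟩ := W.edges.toFinset.exists_min_image (fun e => wt (b e)) (by
    have := hW.three_le_length
    rw [← Walk.length_edges] at this
    obtain ⟨e, he⟩ := List.exists_mem_of_length_pos (by lia : 0 < W.edges.length)
    exact ⟨e, by simpa using he⟩)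
  simp only [List.mem_toFinset] at he₀ hmin
  obtain ⟨a, c, hac, hbac, P, Q, hPQ, hP, hQ⟩ :=
    h.exists_walks_around hb W hW.isTrail he₀ hmin
  rw [hbac] at hP hQ
  refine (egirth_le_of_notMem_edges hac (Q.append P) (by simp [hP, hQ])).trans ?_
  rw [hlen, Walk.length_append]
  exact_mod_cast (by lia : Q.length + P.length + 1 ≤ 3 * W.length)

lemma isLipschitzSubgraph (h : IsWeightedDetour G H b wt) : IsLipschitzSubgraph G H 3 := by
  intro u v huv
  obtain ⟨a, c, hac, -, P, Q, hPQ, -⟩ := h u v huv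
  let W := P.append (Walk.cons hac Q)
  refine ⟨W.reachable, (dist_le W).trans ?_⟩
  simp only [W, Walk.length_append, Walk.length_cons]
  lia

end IsWeightedDetour

open scoped symmDiff

variable [Fintype V]

/-- A finite acyclic graph with an edge has a vertex with exactly one neighbour. -/
lemma IsAcyclic.exists_leaf {F : SimpleGraph V} (hF : F.IsAcyclic) (hne : F ≠ ⊥) :
    ∃ x q, F.Adj x q ∧ ∀ y, F.Adj x y → y = q := by
  obtain ⟨a, c, hac⟩ := ne_bot_iff_exists_adj.1 hne
  have : Nonempty V := ⟨a⟩
  obtain ⟨u, v, P, hP, hmax⟩ := Walk.exists_isPath_forall_isPath_length_le_length F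
  have hlen : 1 ≤ P.length := by
    simpa using hmax a c hac.toWalk (by simp [Walk.cons_isPath_iff, hac.ne])
  refine ⟨v, P.penultimate, (P.adj_penultimate ?_).symm, fun y hy => ?_⟩
  · rw [Walk.not_nil_iff_lt_length]
    lia
  · refine hF.eq_penultimate_of_adj_end hP hy ?_
    by_contra hys
    have := hmax _ _ _ (hP.concat hys hy)
    simp at this

open Classical in
/-- A finite forest can be oriented along parent edges `x → p x`, increasing the rank `r`, so that
half of the edges at every vertex (rounded down) are selected and oriented inwards. -/
lemma IsAcyclic.exists_half_inward {F : SimpleGraph V} (hF : F.IsAcyclic) :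
    ∃ (A : Finset V) (p : V → V) (r : V → ℕ), (∀ x ∈ A, F.Adj x (p x)) ∧
      (∀ x ∈ A, r x < r (p x)) ∧ ∀ v, (A.filter (p · = v)).card = F.degree v / 2 := by
  induction hn : F.edgeFinset.card using Nat.strong_induction_on generalizing F with
  | _ n ih =>
    by_cases hne : F = ⊥
    · subst hne
      exact ⟨∅, id, 0, by simp, by simp, by simp⟩
    obtain ⟨x, q, hxq, huniq⟩ := hF.exists_leaf hne
    have hF'adj : ∀ u v, (F.deleteEdges {s(x, q)}).Adj u v ↔ F.Adj u v ∧ s(u, v) ≠ s(x, q) := by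
      simp [deleteEdges_adj]
    have hF'le : F.deleteEdges {s(x, q)} ≤ F := deleteEdges_le _
    generalize F.deleteEdges {s(x, q)} = F' at hF'adj hF'le
    obtain ⟨A, p, r, hA, hr, hdeg⟩ := ih F'.edgeFinset.card (by
      rw [← hn]
      refine Finset.card_lt_card (edgeFinset_ssubset_edgeFinset.2 (lt_of_le_of_ne hF'le ?_))
      rintro rfl
      exact ((hF'adj x q).1 hxq).2 rfl) (hF.anti hF'le) rfl
    have hiso : ∀ y, ¬ F'.Adj x y := fun y hy => by
      obtain ⟨h1, h2⟩ := (hF'adj _ _).1 hy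
      exact h2 (by rw [huniq y h1])
    have hxA : x ∉ A := fun h => hiso _ (hA x h)
    have hpx : ∀ y ∈ A, p y ≠ x := fun y hy h => hiso y (h ▸ (hA y hy).symm)
    have hdx : F.degree x = 1 := by
      rw [← card_neighborFinset_eq_degree, Finset.card_eq_one]
      exact ⟨q, by ext y; simp only [mem_neighborFinset, Finset.mem_singleton]
                   exact ⟨huniq y, fun h => h ▸ hxq⟩⟩
    have hdq : F.degree q = F'.degree q + 1 := by
      rw [← card_neighborFinset_eq_degree, ← card_neighborFinset_eq_degree,
        ← Finset.card_insert_of_notMem (a := x)]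
      · congr 1
        ext y
        simp only [mem_neighborFinset, Finset.mem_insert, hF'adj]
        have := hxq.symm
        by_cases hy : y = x <;> simp_all
      · simpa using fun h => hiso q h.symm
    have hdo : ∀ v, v ≠ x → v ≠ q → F.degree v = F'.degree v := by
      intro v hvx hvq
      rw [← card_neighborFinset_eq_degree, ← card_neighborFinset_eq_degree]
      congr 1
      ext y
      simp only [mem_neighborFinset, hF'adj]
      simp [hvx, hvq]
    have hqx : q ≠ x := hxq.ne'
    by_cases hodd : F'.degree q % 2 = 1
    · have hpA : ∀ y ∈ A, Function.update p x q y = p y := fun y hy =>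
        Function.update_of_ne (by rintro rfl; exact hxA hy) _ _
      refine ⟨insert x A, Function.update p x q, Function.update (fun y => r y + 1) x 0, ?_, ?_, ?_⟩
      · intro y hy
        rcases Finset.mem_insert.1 hy with rfl | hy
        · simpa using hxq
        · rw [hpA y hy]
          exact hF'le (hA y hy)
      · intro y hy
        rcases Finset.mem_insert.1 hy with rfl | hyA
        · simp [hqx]
        · have hyx : y ≠ x := fun h => hxA (h ▸ hyA)
          rw [hpA y hyA, Function.update_of_ne hyx, Function.update_of_ne (hpx y hyA)]
          have := hr y hyA
          lia
      · intro v
        have hfil : A.filter (Function.update p x q · = v) = A.filter (p · = v) :=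
          Finset.filter_congr fun y hy => by rw [hpA y hy]
        rw [Finset.filter_insert, Function.update_self, hfil]
        have := hdeg v
        by_cases hvq : q = v
        · subst hvq
          rw [if_pos rfl, Finset.card_insert_of_notMem (by simp [hxA])]
          lia
        · rw [if_neg hvq]
          by_cases hvx : v = x
          · subst hvx
            rw [hdx, Finset.filter_eq_empty_iff.2 hpx]
            rfl
          · rw [hdo v hvx (Ne.symm hvq), this]
    · refine ⟨A, p, r, fun y hy => hF'le (hA y hy), hr, fun v => ?_⟩
      by_cases hvx : v = x
      · subst hvx
        rw [hdx, Finset.filter_eq_empty_iff.2 hpx]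
        rfl
      · rw [hdeg]
        by_cases hvq : v = q
        · subst hvq
          lia
        · rw [hdo v hvx hvq]

open Classical in
/-- A finite graph `G` has a subgraph with the same degree parities as `G` that meets every cycle of
`G` in at most half of its edges. -/
lemma exists_le_degree_mod_two_forall_isCycle (G : SimpleGraph V) :
    ∃ F ≤ G, (∀ v, F.degree v % 2 = G.degree v % 2) ∧
      ∀ (a : V) (w : G.Walk a a), w.IsCycle →
        2 * (w.edges.toFinset ∩ F.edgeFinset).card ≤ w.length := by
  obtain ⟨F, hF, hmin⟩ := (Finset.univ.filter
    fun F : SimpleGraph V => F ≤ G ∧ ∀ v, F.degree v % 2 = G.degree v % 2).exists_min_image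
      (fun F => F.edgeFinset.card) ⟨G, by simp⟩
  simp only [Finset.mem_filter, Finset.mem_univ, true_and] at hF hmin
  refine ⟨F, hF.1, hF.2, fun a w hw => ?_⟩
  set C := w.toSubgraph.spanningCoe with hC
  have hCe : C.edgeFinset = w.edges.toFinset := by
    ext e
    simp [hC]
  have hCcard : w.edges.toFinset.card = w.length := by
    rw [List.toFinset_card_of_nodup hw.isTrail.edges_nodup, Walk.length_edges]
  have hCdeg : ∀ v, C.degree v % 2 = 0 := by
    intro v
    rw [← card_neighborFinset_eq_degree]
    by_cases hv : (C.neighborSet v).Nonempty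
    · have := hw.isCycles_spanningCoe_toSubgraph hv
      rw [neighborFinset, ← Set.ncard_eq_toFinset_card', this]
    · rw [Set.not_nonempty_iff_eq_empty] at hv
      rw [neighborFinset, ← Set.ncard_eq_toFinset_card', hv]
      simp
  have key : ∀ S T : Finset (Sym2 V), (S ∆ T).card + 2 * (S ∩ T).card = S.card + T.card := by
    intro S T
    have h1 : (S ∆ T).card = (S \ T).card + (T \ S).card := by
      rw [symmDiff_def, Finset.sup_eq_union, Finset.card_union_of_disjoint]
      exact Finset.disjoint_left.2 fun e h1 h2 => by simp_all
    have h2 := Finset.card_sdiff_add_card_inter S T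
    have h3 := Finset.card_sdiff_add_card_inter T S
    rw [Finset.inter_comm] at h3
    lia
  have hE : (F ∆ C).edgeFinset = F.edgeFinset ∆ C.edgeFinset := by
    ext e
    induction e with
    | _ x y =>
      simp only [Finset.mem_symmDiff, mem_edgeFinset, mem_edgeSet]
      simp [symmDiff_def]
  have hle := hmin (F ∆ C) ⟨?_, fun v => ?_⟩
  · have := key F.edgeFinset C.edgeFinset
    rw [← hE, hCe, hCcard, Finset.inter_comm] at this
    lia
  · exact symmDiff_le_sup.trans (sup_le hF.1 w.toSubgraph.spanningCoe_le)
  · have := key (F.incidenceFinset v) (C.incidenceFinset v)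
    have hi : (F ∆ C).incidenceFinset v = F.incidenceFinset v ∆ C.incidenceFinset v := by
      simp only [incidenceFinset_eq_filter, hE]
      ext e
      simp only [Finset.mem_filter, Finset.mem_symmDiff]
      tauto
    rw [← hi] at this
    simp only [card_incidenceFinset_eq_degree] at this
    have h1 := hCdeg v
    have h2 := hF.2 v
    lia

end SimpleGraph

/-- The number of elements of a finite set of unordered pairs which contain a given vertex. -/
lemma Sym2.card_filter_mem_image {V : Type*} [DecidableEq V] (A : Finset V) (f g : V → V)
    (hinj : Set.InjOn (fun x => s(f x, g x)) A) (hne : ∀ x ∈ A, f x ≠ g x) (v : V) :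
    ((A.image fun x => s(f x, g x)).filter (v ∈ ·)).card =
      (A.filter (f · = v)).card + (A.filter (g · = v)).card := by
  rw [Finset.filter_image, Finset.card_image_of_injOn (hinj.mono (Finset.filter_subset _ _)),
    ← Finset.card_union_of_disjoint]
  · congr 1
    ext x
    simp only [Finset.mem_filter, Sym2.mem_iff, Finset.mem_union]
    grind
  · exact Finset.disjoint_left.2 fun x hx hy => by
      simp only [Finset.mem_filter] at hx hy
      exact hne x hx.1 (hx.2.trans hy.2.symm)

/-- A weighted form of Hall's theorem: a fractional system of representatives with total load at
most one on every element can be rounded to a system of distinct representatives. -/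
lemma Finset.exists_injective_of_sum_le_one {ι α : Type*} [DecidableEq α] (t : ι → Finset α)
    (w : ι → ℚ) (hw : ∀ i, 1 ≤ (t i).card * w i)
    (hload : ∀ (S : Finset ι) (e : α), ∑ i ∈ S with e ∈ t i, w i ≤ 1) :
    ∃ f : ι → α, Function.Injective f ∧ ∀ i, f i ∈ t i := by
  refine (Finset.all_card_le_biUnion_card_iff_exists_injective t).1 fun S => ?_
  have h : (S.card : ℚ) ≤ ((S.biUnion t).card : ℚ) := calc
    (S.card : ℚ) = ∑ i ∈ S, (1 : ℚ) := by simp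
    _ ≤ ∑ i ∈ S, ∑ e ∈ t i, w i := Finset.sum_le_sum fun i _ => by simpa using hw i
    _ = ∑ e ∈ S.biUnion t, ∑ i ∈ S with e ∈ t i, w i :=
      Finset.sum_comm' fun i e => by
        simp only [Finset.mem_biUnion, Finset.mem_filter]
        exact ⟨fun h => ⟨h, i, h⟩, fun h => h.1⟩
    _ ≤ ∑ e ∈ S.biUnion t, (1 : ℚ) := Finset.sum_le_sum fun e _ => hload S e
    _ = ((S.biUnion t).card : ℚ) := by simp
  exact_mod_cast h

namespace SimpleGraph

variable {V : Type*} [Fintype V]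

open Classical in
/-- Every selected leaf `x ∈ L` can be assigned a neighbour `z x` not adjacent to `p x`, in such a
way that the pairs `{p x, z x}` are distinct. -/
lemma exists_distinct_nonadjacent_pairs (G F : SimpleGraph V) (L : Finset V) (p : V → V)
    (hp : ∀ x ∈ L, F.Adj x (p x)) (hFG : F ≤ G)
    (hdeg : ∀ x ∈ L, G.degree (p x) + 1 ≤ G.degree x)
    (hload : ∀ v, 2 * (L.filter (p · = v)).card ≤ F.degree v)
    (htri : ∀ x y q, F.Adj x q → F.Adj y q → ¬ G.Adj x y) :
    ∃ z : V → V, (∀ x ∈ L, G.Adj x (z x) ∧ z x ≠ p x ∧ ¬ G.Adj (p x) (z x)) ∧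
      ∀ x ∈ L, ∀ y ∈ L, s(p x, z x) = s(p y, z y) → x = y := by
  let Z : V → Finset V := fun x =>
    G.neighborFinset x \ insert (p x) (G.neighborFinset (p x) \ F.neighborFinset (p x))
  have hZ : ∀ x ∈ L, F.degree (p x) ≤ (Z x).card := by
    intro x hx
    have h1 := Finset.le_card_sdiff
      (insert (p x) (G.neighborFinset (p x) \ F.neighborFinset (p x))) (G.neighborFinset x)
    have h2 := Finset.card_insert_le (p x) (G.neighborFinset (p x) \ F.neighborFinset (p x))
    have hsub : F.neighborFinset (p x) ⊆ G.neighborFinset (p x) := fun y hy => by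
      rw [mem_neighborFinset] at hy ⊢
      exact hFG hy
    rw [Finset.card_sdiff_of_subset hsub] at h2
    have h3 := Finset.card_le_card hsub
    simp only [card_neighborFinset_eq_degree] at h1 h2 h3
    have := hdeg x hx
    change _ ≤ (_ \ _ : Finset V).card
    lia
  have hmem : ∀ x ∈ L, ∀ y ∈ Z x, G.Adj x y ∧ y ≠ p x ∧ ¬ G.Adj (p x) y := by
    intro x hx y hy
    simp only [Z, Finset.mem_sdiff, mem_neighborFinset, Finset.mem_insert, not_or, not_and,
      not_not] at hy
    exact ⟨hy.1, hy.2.1, fun h => htri x y (p x) (hp x hx) (hy.2.2 h).symm hy.1⟩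
  have hpos : ∀ x ∈ L, 0 < F.degree (p x) := fun x hx =>
    (F.degree_pos_iff_exists_adj _).2 ⟨x, (hp x hx).symm⟩
  obtain ⟨f, hf, hft⟩ := Finset.exists_injective_of_sum_le_one
    (fun x : L => (Z x).image (s(p x, ·))) (fun x => (F.degree (p x) : ℚ)⁻¹) (by
      rintro ⟨x, hx⟩
      have hinj : Function.Injective (s(p x, ·)) := fun _ _ => Sym2.congr_right.1
      rw [Finset.card_image_of_injective _ hinj, ← div_eq_mul_inv, one_le_div]
      · exact_mod_cast hZ x hx
      · exact_mod_cast hpos x hx) (by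
      intro S e
      have hhalf : ∀ a, ∑ x ∈ S.filter (fun x : L => p x = a), (F.degree (p x) : ℚ)⁻¹ ≤ 1 / 2 := by
        intro a
        have hcard : (S.filter (fun x : L => p x = a)).card ≤ (L.filter (p · = a)).card := by
          refine Finset.card_le_card_of_injOn Subtype.val (fun x hx => ?_) Subtype.val_injective.injOn
          have hx' := (Finset.mem_filter.1 hx).2
          simp [hx']
        rw [Finset.sum_congr rfl (g := fun _ => (F.degree a : ℚ)⁻¹) fun x hx => by
          rw [(Finset.mem_filter.1 hx).2], Finset.sum_const, nsmul_eq_mul, ← div_eq_mul_inv]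
        rcases Nat.eq_zero_or_pos (F.degree a) with h0 | h0
        · simp [h0]
        · rw [div_le_div_iff₀ (by exact_mod_cast h0) (by norm_num)]
          have := hload a
          exact_mod_cast (by lia : (S.filter (fun x : L => p x = a)).card * 2 ≤ 1 * F.degree a)
      induction e with
      | _ a c =>
        calc _ ≤ ∑ x ∈ S.filter (fun x : L => p x = a) ∪ S.filter (fun x : L => p x = c),
              (F.degree (p x) : ℚ)⁻¹ := by
              refine Finset.sum_le_sum_of_subset_of_nonneg (fun x hx => ?_)
                fun _ _ _ => by positivity
              obtain ⟨hxS, hx⟩ := Finset.mem_filter.1 hx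
              obtain ⟨y, -, hy⟩ := Finset.mem_image.1 hx
              have := Sym2.eq_iff.1 hy
              simp only [Finset.mem_union, Finset.mem_filter]
              tauto
          _ ≤ ∑ x ∈ S.filter (fun x : L => p x = a), (F.degree (p x) : ℚ)⁻¹ +
              ∑ x ∈ S.filter (fun x : L => p x = c), (F.degree (p x) : ℚ)⁻¹ := by
              rw [← Finset.sum_union_inter]
              exact le_add_of_nonneg_right (Finset.sum_nonneg fun _ _ => by positivity)
          _ ≤ 1 := by linarith [hhalf a, hhalf c])
  have hz : ∀ x : L, ∃ z ∈ Z x, s(p x, z) = f x := fun x => by simpa using hft x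
  choose z hzZ hzf using hz
  refine ⟨fun x => if hx : x ∈ L then z ⟨x, hx⟩ else x, fun x hx => ?_, fun x hx y hy hxy => ?_⟩
  · simpa only [dif_pos hx] using hmem x hx _ (hzZ ⟨x, hx⟩)
  · simp only [dif_pos hx, dif_pos hy] at hxy
    rw [hzf ⟨x, hx⟩, hzf ⟨y, hy⟩] at hxy
    exact congrArg Subtype.val (hf hxy)

open Classical in
/-- For a subgraph `F` meeting every cycle of `G` in at most half of its edges, adjacent vertices of
`G` have no common `F`-neighbour. -/
lemma not_adj_of_forall_isCycle {G F : SimpleGraph V} (hFG : F ≤ G)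
    (hF : ∀ (a : V) (w : G.Walk a a), w.IsCycle →
      2 * (w.edges.toFinset ∩ F.edgeFinset).card ≤ w.length)
    (x y q : V) (hx : F.Adj x q) (hy : F.Adj y q) : ¬ G.Adj x y := by
  intro hxy
  have hcyc : (Walk.cons (hFG hx) (Walk.cons (hFG hy).symm
      (Walk.cons hxy.symm Walk.nil))).IsCycle := by
    have := hx.ne
    have := hy.ne
    have := hxy.ne
    simp only [Walk.cons_isCycle_iff, Walk.cons_isPath_iff, Walk.isPath_iff_nil, Walk.nil_nil,
      Walk.support_cons, Walk.support_nil, Walk.edges_cons, Walk.edges_nil]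
    grind
  have h := hF _ _ hcyc
  have hsub : ({s(x, q), s(y, q)} : Finset (Sym2 V)) ⊆
      (Walk.cons (hFG hx) (Walk.cons (hFG hy).symm
      (Walk.cons hxy.symm Walk.nil))).edges.toFinset ∩ F.edgeFinset := by
    intro e he
    simp only [Finset.mem_insert, Finset.mem_singleton] at he
    rcases he with rfl | rfl
    · simp [hx]
    · simp [hy, Sym2.eq_swap]
  have h2 := Finset.card_le_card hsub
  rw [Finset.card_pair (by simp [hxy.ne, hx.ne])] at h2
  simp only [Walk.length_cons, Walk.length_nil] at h
  lia

open Classical in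
/-- For a subgraph `F` meeting every cycle of `G` in at most half of its edges, no `F`-path with
three edges is closed up by an edge of `G`. -/
lemma not_adj_of_forall_isCycle_of_path {G F : SimpleGraph V} (hFG : F ≤ G)
    (hF : ∀ (a : V) (w : G.Walk a a), w.IsCycle →
      2 * (w.edges.toFinset ∩ F.edgeFinset).card ≤ w.length)
    (a b c d : V) (hab : F.Adj a b) (hbc : F.Adj b c) (hcd : F.Adj c d) (hac : a ≠ c)
    (hbd : b ≠ d) : ¬ G.Adj d a := by
  intro hda
  have hcyc : (Walk.cons (hFG hab) (Walk.cons (hFG hbc)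
      (Walk.cons (hFG hcd) (Walk.cons hda Walk.nil)))).IsCycle := by
    have := hab.ne
    have := hbc.ne
    have := hcd.ne
    have := hda.ne
    simp only [Walk.cons_isCycle_iff, Walk.cons_isPath_iff, Walk.isPath_iff_nil, Walk.nil_nil,
      Walk.support_cons, Walk.support_nil, Walk.edges_cons, Walk.edges_nil]
    grind
  have h := hF _ _ hcyc
  have hsub : ({s(a, b), s(b, c), s(c, d)} : Finset (Sym2 V)) ⊆
      (Walk.cons (hFG hab) (Walk.cons (hFG hbc)
      (Walk.cons (hFG hcd) (Walk.cons hda Walk.nil)))).edges.toFinset ∩ F.edgeFinset := by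
    intro e he
    simp only [Finset.mem_insert, Finset.mem_singleton] at he
    rcases he with rfl | rfl | rfl
    · simp [hab]
    · simp [hbc]
    · simp [hcd]
  have h2 := Finset.card_le_card hsub
  have h3 : ({s(a, b), s(b, c), s(c, d)} : Finset (Sym2 V)).card = 3 :=
    Finset.card_eq_three.2 ⟨_, _, _, by simp [hac, hab.ne], by
      simp [hda.ne', hac], by simp [hbd, hbc.ne], rfl⟩
  simp only [Walk.length_cons, Walk.length_nil] at h
  lia

open Classical in
/-- A subgraph meeting every cycle of `G` in at most half of its edges is acyclic. -/
lemma isAcyclic_of_forall_isCycle {G F : SimpleGraph V} (hFG : F ≤ G)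
    (hF : ∀ (a : V) (w : G.Walk a a), w.IsCycle →
      2 * (w.edges.toFinset ∩ F.edgeFinset).card ≤ w.length) : F.IsAcyclic := by
  intro a w hw
  have h := hF a (w.mapLe hFG) (hw.mapLe hFG)
  have hedges : (w.mapLe hFG).edges = w.edges := by simp
  rw [hedges, Finset.inter_eq_left.2 (fun e he => by
      rw [mem_edgeFinset]
      exact w.edges_subset_edgeSet (List.mem_toFinset.1 he)),
    List.toFinset_card_of_nodup hw.isTrail.edges_nodup, Walk.length_edges,
    Walk.length_mapLe] at h
  have := hw.three_le_length
  lia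

open Classical in
/-- Replace each edge `s(x, z x)`, `x ∈ A`, of `G` by `s(p x, z x)`, and delete the edges of `F` other
than the edges `s(x, p x)`, `x ∈ A`. -/
noncomputable def slideEdges (G F : SimpleGraph V) (A : Finset V) (p z : V → V) :
    Finset (Sym2 V) :=
  (G.edgeFinset \ ((F.edgeFinset \ A.image fun x => s(x, p x)) ∪ A.image fun x => s(x, z x))) ∪
    A.image fun x => s(p x, z x)

open Classical in
lemma card_filter_mem_slideEdges {G F : SimpleGraph V} {A : Finset V} {p z : V → V}
    (hFG : F ≤ G) (hp : ∀ x ∈ A, F.Adj x (p x)) (hz : ∀ x ∈ A, G.Adj x (z x))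
    (hzF : ∀ x ∈ A, F.Adj x (z x) → ∃ y ∈ A, s(x, z x) = s(y, p y))
    (hpz : ∀ x ∈ A, p x ≠ z x) (hpzG : ∀ x ∈ A, ¬ G.Adj (p x) (z x))
    (hinj₁ : Set.InjOn (fun x => s(x, p x)) A) (hinj₂ : Set.InjOn (fun x => s(x, z x)) A)
    (hinj₃ : Set.InjOn (fun x => s(p x, z x)) A) (v : V) :
    ((slideEdges G F A p z).filter (v ∈ ·)).card + F.degree v =
      G.degree v + 2 * (A.filter (p · = v)).card := by
  have hc₁ := Sym2.card_filter_mem_image A id p hinj₁ (fun x hx => (hp x hx).ne) v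
  have hc₂ := Sym2.card_filter_mem_image A id z hinj₂ (fun x hx => (hz x hx).ne) v
  have hc₃ := Sym2.card_filter_mem_image A p z hinj₃ hpz v
  simp only [id] at hc₁ hc₂
  have hdG : (G.edgeFinset.filter (v ∈ ·)).card = G.degree v := by
    rw [← card_incidenceFinset_eq_degree, incidenceFinset_eq_filter]
  have hdF : (F.edgeFinset.filter (v ∈ ·)).card = F.degree v := by
    rw [← card_incidenceFinset_eq_degree, incidenceFinset_eq_filter]
  have hsub₁ : (A.image fun x => s(x, p x)) ⊆ F.edgeFinset := by
    intro e he
    obtain ⟨x, hx, rfl⟩ := Finset.mem_image.1 he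
    simpa using hp x hx
  have hsub₂ : (A.image fun x => s(x, z x)) ⊆ G.edgeFinset := by
    intro e he
    obtain ⟨x, hx, rfl⟩ := Finset.mem_image.1 he
    simpa using hz x hx
  have hsubF : F.edgeFinset ⊆ G.edgeFinset := edgeFinset_mono hFG
  have hdisj : Disjoint (F.edgeFinset \ A.image fun x => s(x, p x))
      (A.image fun x => s(x, z x)) := by
    refine Finset.disjoint_left.2 fun e he he' => ?_
    obtain ⟨x, hx, rfl⟩ := Finset.mem_image.1 he'
    rw [Finset.mem_sdiff, mem_edgeFinset, mem_edgeSet] at he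
    obtain ⟨y, hy, hxy⟩ := hzF x hx he.1
    exact he.2 (Finset.mem_image.2 ⟨y, hy, hxy.symm⟩)
  have hdisj₃ : Disjoint G.edgeFinset (A.image fun x => s(p x, z x)) := by
    refine Finset.disjoint_left.2 fun e he he' => ?_
    obtain ⟨x, hx, rfl⟩ := Finset.mem_image.1 he'
    exact hpzG x hx (by simpa using he)
  unfold slideEdges
  generalize (A.image fun x => s(x, p x)) = D₁ at *
  generalize (A.image fun x => s(x, z x)) = D₂ at *
  generalize (A.image fun x => s(p x, z x)) = D₃ at *
  have hsubU : (F.edgeFinset \ D₁) ∪ D₂ ⊆ G.edgeFinset :=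
    Finset.union_subset (Finset.sdiff_subset.trans hsubF) hsub₂
  have hadd : ∀ S T : Finset (Sym2 V), Disjoint S T →
      ((S ∪ T).filter (v ∈ ·)).card = (S.filter (v ∈ ·)).card + (T.filter (v ∈ ·)).card := by
    intro S T h
    rw [Finset.filter_union, Finset.card_union_of_disjoint (Finset.disjoint_filter_filter h)]
  have h₁ := hadd _ _ (Finset.sdiff_disjoint : Disjoint (F.edgeFinset \ D₁) D₁)
  rw [Finset.sdiff_union_of_subset hsub₁] at h₁
  have h₂ := hadd _ _ (Finset.sdiff_disjoint :
    Disjoint (G.edgeFinset \ ((F.edgeFinset \ D₁) ∪ D₂)) ((F.edgeFinset \ D₁) ∪ D₂))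
  rw [Finset.sdiff_union_of_subset hsubU, hadd _ _ hdisj] at h₂
  rw [hadd _ _ (hdisj₃.mono_left Finset.sdiff_subset)]
  lia

open Classical in
lemma mem_edgeSet_fromEdgeSet_slideEdges {G F : SimpleGraph V} {A : Finset V} {p z : V → V}
    (hpz : ∀ x ∈ A, p x ≠ z x) (e : Sym2 V) :
    e ∈ (fromEdgeSet (slideEdges G F A p z : Set (Sym2 V))).edgeSet ↔
      e ∈ slideEdges G F A p z := by
  rw [edgeSet_fromEdgeSet, Set.mem_sdiff, Finset.mem_coe, and_iff_left_iff_imp]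
  intro he
  rcases Finset.mem_union.1 he with he | he
  · exact G.not_isDiag_of_mem_edgeFinset (Finset.mem_sdiff.1 he).1
  · obtain ⟨x, hx, rfl⟩ := Finset.mem_image.1 he
    simpa using hpz x hx

open Classical in
lemma exists_isWeightedDetour_slideEdges {G F : SimpleGraph V} {A : Finset V} {p z : V → V}
    {r : V → ℕ} (hFG : F ≤ G) (hp : ∀ x ∈ A, F.Adj x (p x)) (hz : ∀ x ∈ A, G.Adj x (z x))
    (hr : ∀ x ∈ A, ∀ y ∈ A, s(x, z x) = s(y, p y) → r y < r x)
    (hpz : ∀ x ∈ A, p x ≠ z x)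
    (hinj₁ : Set.InjOn (fun x => s(x, p x)) A) (hinj₂ : Set.InjOn (fun x => s(x, z x)) A)
    (hinj₃ : Set.InjOn (fun x => s(p x, z x)) A) :
    ∃ b wt, IsWeightedDetour G (fromEdgeSet (slideEdges G F A p z : Set (Sym2 V))) b wt ∧
      Set.InjOn b (fromEdgeSet (slideEdges G F A p z : Set (Sym2 V))).edgeSet := by
  obtain ⟨b, hb, hb'⟩ : ∃ b : Sym2 V → Sym2 V, (∀ x ∈ A, b s(p x, z x) = s(x, z x)) ∧
      ∀ e, (∀ x ∈ A, e ≠ s(p x, z x)) → b e = e := by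
    refine ⟨fun e => if h : ∃ x ∈ A, e = s(p x, z x) then s(h.choose, z h.choose) else e,
      fun x hx => ?_, fun e he => dif_neg (by simpa using he)⟩
    have h : ∃ y ∈ A, s(p x, z x) = s(p y, z y) := ⟨x, hx, rfl⟩
    have hxy : x = h.choose := hinj₃ hx h.choose_spec.1 h.choose_spec.2
    simp only [dif_pos h, ← hxy]
  obtain ⟨wt, hwt, hwt'⟩ : ∃ wt : Sym2 V → ℕ, (∀ x ∈ A, wt s(x, p x) = r x + 1) ∧
      ∀ e, (∀ x ∈ A, e ≠ s(x, p x)) → wt e = 0 := by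
    refine ⟨fun e => if h : ∃ x ∈ A, e = s(x, p x) then r h.choose + 1 else 0,
      fun x hx => ?_, fun e he => dif_neg (by simpa using he)⟩
    have h : ∃ y ∈ A, s(x, p x) = s(y, p y) := ⟨x, hx, rfl⟩
    have hxy : x = h.choose := hinj₁ hx h.choose_spec.1 h.choose_spec.2
    simp only [dif_pos h, ← hxy]
  have hlt : ∀ x ∈ A, wt s(x, z x) < wt s(x, p x) := by
    intro x hx
    rw [hwt x hx]
    by_cases h : ∃ y ∈ A, s(x, z x) = s(y, p y)
    · obtain ⟨y, hy, hxy⟩ := h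
      rw [hxy, hwt y hy]
      have := hr x hx y hy hxy
      lia
    · rw [hwt' _ (by simpa using h)]
      lia
  have hmem : ∀ e, e ∈ slideEdges G F A p z → (∀ x ∈ A, e ≠ s(p x, z x)) →
      e ∈ G.edgeSet ∧ ∀ x ∈ A, e ≠ s(x, z x) := by
    intro e he hne
    simp only [slideEdges, Finset.mem_union, Finset.mem_sdiff, Finset.mem_image, not_or,
      mem_edgeFinset] at he
    rcases he with he | ⟨x, hx, rfl⟩
    · exact ⟨he.1, fun x hx h => he.2.2 ⟨x, hx, h.symm⟩⟩
    · exact absurd rfl (hne x hx)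
  refine ⟨b, wt, fun u v huv => ?_, fun e he f hf hef => ?_⟩
  · rw [← mem_edgeSet, mem_edgeSet_fromEdgeSet_slideEdges hpz] at huv
    by_cases h : ∃ x ∈ A, s(u, v) = s(p x, z x)
    · obtain ⟨x, hx, hxe⟩ := h
      have hbx := hb x hx
      rw [← hxe] at hbx
      have hlx := hlt x hx
      rcases Sym2.eq_iff.1 hxe with ⟨rfl, rfl⟩ | ⟨rfl, rfl⟩
      · refine ⟨x, z x, hz x hx, hbx, Walk.cons (hFG (hp x hx)).symm Walk.nil, Walk.nil, by simp,
          fun e he => ?_⟩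
        have he : e = s(x, p x) := by simpa [Sym2.eq_swap] using he
        rwa [he]
      · refine ⟨z x, x, (hz x hx).symm, hbx.trans Sym2.eq_swap, Walk.nil,
          Walk.cons (hFG (hp x hx)) Walk.nil, by simp, fun e he => ?_⟩
        have he : e = s(x, p x) := by simpa using he
        rwa [he, Sym2.eq_swap (a := z x)]
    · have hne : ∀ x ∈ A, s(u, v) ≠ s(p x, z x) := by simpa using h
      exact ⟨u, v, (hmem _ huv hne).1, hb' _ hne, Walk.nil, Walk.nil, by simp, by simp⟩
  · rw [mem_edgeSet_fromEdgeSet_slideEdges hpz] at he hf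
    by_cases h₁ : ∃ x ∈ A, e = s(p x, z x) <;> by_cases h₂ : ∃ x ∈ A, f = s(p x, z x)
    · obtain ⟨x, hx, rfl⟩ := h₁
      obtain ⟨y, hy, rfl⟩ := h₂
      rw [hb x hx, hb y hy] at hef
      rw [hinj₂ hx hy hef]
    · obtain ⟨x, hx, rfl⟩ := h₁
      have h₂ : ∀ x ∈ A, f ≠ s(p x, z x) := by simpa using h₂
      rw [hb x hx, hb' f h₂] at hef
      exact absurd hef.symm ((hmem f hf h₂).2 x hx)
    · obtain ⟨x, hx, rfl⟩ := h₂
      have h₁ : ∀ x ∈ A, e ≠ s(p x, z x) := by simpa using h₁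
      rw [hb x hx, hb' e h₁] at hef
      exact absurd hef ((hmem e he h₁).2 x hx)
    · rwa [hb' e (by simpa using h₁), hb' f (by simpa using h₂)] at hef

end SimpleGraph

/-- Let `δ ≥ 4` be even and let `G` be a finite graph with minimum degree
`δ`, maximum degree at most `δ + 1`, and no two adjacent vertices both of degree `δ + 1`.
Then `G` has a `δ`-regular spanning `3`-Lipschitz subgraph `H` with girth at least `g(G)/3`
(i.e. `g(G) ≤ 3 * g(H)`). -/
theorem finite_regular_spanning_three_lipschitz
    {V : Type*} [Fintype V] (G : SimpleGraph V) (δ : ℕ)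
    (hδ4 : 4 ≤ δ) (hδeven : Even δ)
    (hmindeg : ∀ v : V, δ ≤ (G.neighborSet v).ncard)
    (hmaxdeg : ∀ v : V, (G.neighborSet v).ncard ≤ δ + 1)
    (hnonadj : ∀ x y : V, G.Adj x y →
      ¬((G.neighborSet x).ncard = δ + 1 ∧ (G.neighborSet y).ncard = δ + 1)) :
    ∃ H : SimpleGraph V,
      IsLipschitzSubgraph G H 3 ∧
      (∀ v : V, (H.neighborSet v).ncard = δ) ∧
      G.egirth ≤ 3 * H.egirth := by
  classical
  have hncard : ∀ (H : SimpleGraph V) v, (H.neighborSet v).ncard = H.degree v := fun H v => by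
    rw [← card_neighborFinset_eq_degree, neighborFinset, Set.ncard_eq_toFinset_card']
  simp only [hncard] at hmindeg hmaxdeg hnonadj ⊢
  obtain ⟨k, hk⟩ := hδeven
  obtain ⟨F, hFG, hpar, hF⟩ := exists_le_degree_mod_two_forall_isCycle G
  have htri := not_adj_of_forall_isCycle hFG hF
  have hquad := not_adj_of_forall_isCycle_of_path hFG hF
  obtain ⟨A, p, r, hp, hr, hcard⟩ := (isAcyclic_of_forall_isCycle hFG hF).exists_half_inward
  have hbig : ∀ x, F.degree x = 1 → G.degree x = δ + 1 := by
    intro x hx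
    have h1 := hpar x
    have h2 := hmindeg x
    have h3 := hmaxdeg x
    lia
  have hchild : ∀ x ∈ A, F.degree x ≠ 1 → ∃ c ∈ A, p c = x := by
    intro x hx hne
    have hpos : 0 < F.degree x := (F.degree_pos_iff_exists_adj x).2 ⟨_, hp x hx⟩
    have := hcard x
    obtain ⟨c, hc⟩ := Finset.card_pos.1 (by lia : 0 < (A.filter (p · = x)).card)
    exact ⟨c, Finset.mem_filter.1 hc⟩
  choose! c hcA hpc using hchild
  obtain ⟨z₀, hz₀, hinj₀⟩ := exists_distinct_nonadjacent_pairs G F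
    (A.filter (F.degree · = 1)) p (fun x hx => hp x (Finset.mem_filter.1 hx).1) hFG
    (fun x hx => by
      obtain ⟨hxA, hx⟩ := Finset.mem_filter.1 hx
      have h1 := hnonadj x (p x) (hFG (hp x hxA))
      have h2 := hbig x hx
      have h3 := hmaxdeg (p x)
      lia)
    (fun v => by
      have h1 := Finset.card_le_card (Finset.filter_subset_filter (p · = v)
        (Finset.filter_subset (F.degree · = 1) A))
      have h2 := hcard v
      lia) htri
  -- A leaf is shifted along a new edge, any other vertex along an edge to a child.
  obtain ⟨z, hzleaf, hzinner⟩ : ∃ z : V → V, (∀ x, F.degree x = 1 → z x = z₀ x) ∧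
      ∀ x, F.degree x ≠ 1 → z x = c x :=
    ⟨fun x => if F.degree x = 1 then z₀ x else c x, fun x hx => if_pos hx, fun x hx => if_neg hx⟩
  have hleaf : ∀ x ∈ A, F.degree x = 1 →
      G.Adj x (z x) ∧ z x ≠ p x ∧ ¬ G.Adj (p x) (z x) ∧ ¬ F.Adj x (z x) := by
    intro x hx hdx
    obtain ⟨h1, h2, h3⟩ := hz₀ x (Finset.mem_filter.2 ⟨hx, hdx⟩)
    rw [hzleaf x hdx]
    refine ⟨h1, h2, h3, fun h => h2 ?_⟩
    obtain ⟨y, -, hy⟩ := (degree_eq_one_iff_existsUnique_adj).1 hdx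
    rw [hy _ h, hy _ (hp x hx)]
  have hinner : ∀ x ∈ A, F.degree x ≠ 1 → z x ∈ A ∧ p (z x) = x ∧ F.Adj x (z x) := by
    intro x hx hdx
    rw [hzinner x hdx]
    have h := hp _ (hcA x hx hdx)
    rw [hpc x hx hdx] at h
    exact ⟨hcA x hx hdx, hpc x hx hdx, h.symm⟩
  have hz : ∀ x ∈ A, G.Adj x (z x) := fun x hx => by
    by_cases hdx : F.degree x = 1
    · exact (hleaf x hx hdx).1
    · exact hFG (hinner x hx hdx).2.2
  have hpz : ∀ x ∈ A, p x ≠ z x := fun x hx h => by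
    by_cases hdx : F.degree x = 1
    · exact (hleaf x hx hdx).2.1 h.symm
    · obtain ⟨h1, h2, -⟩ := hinner x hx hdx
      have h3 := hr _ h1
      have h4 := hr x hx
      rw [h2, ← h] at h3
      lia
  have hpzG : ∀ x ∈ A, ¬ G.Adj (p x) (z x) := fun x hx => by
    by_cases hdx : F.degree x = 1
    · exact (hleaf x hx hdx).2.2.1
    · exact htri _ _ x (hp x hx).symm (hinner x hx hdx).2.2.symm
  have hinj₁ : Set.InjOn (fun x => s(x, p x)) A := fun x hx y hy hxy => by
    rcases Sym2.eq_iff.1 hxy with h | ⟨h1, h2⟩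
    · exact h.1
    · have h3 := hr x hx
      have h4 := hr y hy
      rw [h2] at h3
      rw [← h1] at h4
      lia
  have hlabel : ∀ x ∈ A, F.Adj x (z x) → s(x, z x) = s(z x, p (z x)) ∧ z x ∈ A := by
    intro x hx hF
    by_cases hdx : F.degree x = 1
    · exact absurd hF (hleaf x hx hdx).2.2.2
    · obtain ⟨h1, h2, -⟩ := hinner x hx hdx
      exact ⟨by rw [h2, Sym2.eq_swap], h1⟩
  have hinj₂ : Set.InjOn (fun x => s(x, z x)) A := fun x hx y hy hxy => by
    rcases Sym2.eq_iff.1 hxy with h | ⟨h1, h2⟩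
    · exact h.1
    by_cases hxyF : F.Adj x y
    · have h3 := (hlabel x hx (h2 ▸ hxyF)).1
      have h4 := (hlabel y hy (h1 ▸ hxyF.symm)).1
      rw [h2] at h3
      rw [← h1] at h4
      exact hinj₁ hx hy (h4.symm.trans (Sym2.eq_swap.trans h3))
    · have h3 : F.degree x = 1 := by
        by_contra h
        exact hxyF (h2 ▸ (hinner x hx h).2.2)
      have h4 : F.degree y = 1 := by
        by_contra h
        exact hxyF (h1 ▸ (hinner y hy h).2.2.symm)
      exact absurd ⟨hbig x h3, hbig y h4⟩ (hnonadj x y (h2 ▸ hz x hx))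
  -- An `F`-path `p y, y, z y` with the same ends as a different path `p x, x, z x` would give a
  -- cycle of length four with at least three edges in `F`.
  have hmixed : ∀ x ∈ A, ∀ y ∈ A, F.degree y ≠ 1 → s(p x, z x) = s(p y, z y) → x = y := by
    intro x hx y hy hdy hxy
    by_contra hne
    have h1 := (hinner y hy hdy).2.2
    have h2 := hp y hy
    rcases Sym2.eq_iff.1 hxy with ⟨h3, h4⟩ | ⟨h3, h4⟩
    · exact hquad x (p x) y (z x) (hp x hx) (h3 ▸ h2.symm) (h4 ▸ h1) hne (hpz x hx) (hz x hx).symm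
    · exact hquad x (p x) y (z x) (hp x hx) (h3 ▸ h1.symm) (h4 ▸ h2) hne (hpz x hx) (hz x hx).symm
  have hinj₃ : Set.InjOn (fun x => s(p x, z x)) A := fun x hx y hy hxy => by
    by_cases hdy : F.degree y = 1
    · by_cases hdx : F.degree x = 1
      · simp only [hzleaf x hdx, hzleaf y hdy] at hxy
        exact hinj₀ x (Finset.mem_filter.2 ⟨hx, hdx⟩) y (Finset.mem_filter.2 ⟨hy, hdy⟩) hxy
      · exact (hmixed y hy x hx hdx hxy.symm).symm
    · exact hmixed x hx y hy hdy hxy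
  obtain ⟨b, wt, hdetour, hb⟩ := exists_isWeightedDetour_slideEdges (r := r) hFG hp hz
    (fun x hx y hy hxy => by
      have hxF : F.Adj x (z x) := by
        rw [← mem_edgeSet, hxy]
        exact hp y hy
      obtain ⟨h1, h2⟩ := hlabel x hx hxF
      have hzy : z x = y := hinj₁ h2 hy (h1.symm.trans hxy)
      have h3 := hr y hy
      have h4 : p y = x := by
        rcases Sym2.eq_iff.1 hxy with h | h
        · exact absurd (h.1.trans hzy.symm) (hz x hx).ne
        · exact h.1.symm
      rwa [h4] at h3) hpz hinj₁ hinj₂ hinj₃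
  refine ⟨_, hdetour.isLipschitzSubgraph, fun v => ?_, hdetour.egirth_le hb⟩
  have hcount := card_filter_mem_slideEdges hFG hp hz
    (fun x hx h => ⟨z x, (hlabel x hx h).2, (hlabel x hx h).1⟩) hpz hpzG hinj₁ hinj₂ hinj₃ v
  have hedge : (fromEdgeSet (slideEdges G F A p z : Set (Sym2 V))).edgeFinset =
      slideEdges G F A p z := by
    ext e
    rw [mem_edgeFinset, mem_edgeSet_fromEdgeSet_slideEdges hpz]
  rw [← card_incidenceFinset_eq_degree, incidenceFinset_eq_filter, hedge]
  rw [hcard v] at hcount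
  have h1 := hpar v
  have h2 := hmindeg v
  have h3 := hmaxdeg v
  lia
end
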